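/- There exists G ≥ 1 such that for all g ≥ G: there are GL(H)-equivariant ℚ-linear isomorphisms C₁₂^{(2)} ≅ (Sym²H)^{⊕3} and Ω̃₂^{(2)} ≅ Sym²H, where Sym²H is the second symmetric power of H with its natural GL(H)-action. (The n = 4 row of Proposition 4.1 of the paper: C_{1,2}ℋ(4) ≅ 3[2] and Ω̃_{2,2} ≅ [2] as GL-representations.) -/

import Mathlib

open TensorProduct

set_option maxSynthPendingDepth 4

noncomputable section

/-- The symplectic vector space `H = ℚ^{2g}`. -/
abbrev Hsp (g : ℕ) : Type := Fin (2 * g) → ℚ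

/-- The tensor algebra `T = T(H)`. -/
abbrev TA (g : ℕ) : Type := TensorAlgebra ℚ (Hsp g)

/-- The antipode `x ↦ x̄`, determined by `overline (u₁⋯u_m) = (−1)^m u_m⋯u₁`. -/
def barT (g : ℕ) : TA g →ₗ[ℚ] TA g :=
  (MulOpposite.opLinearEquiv ℚ (M := TA g)).symm.toLinearMap ∘ₗ
    (TensorAlgebra.lift ℚ
      ((MulOpposite.opLinearEquiv ℚ (M := TA g)).toLinearMap ∘ₗ
        (-(TensorAlgebra.ι ℚ (M := Hsp g))))).toLinearMap

/-- The coproduct `Δ : T → T ⊗ T`, the algebra homomorphism with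
`Δ(u) = u ⊗ 1 + 1 ⊗ u` for `u ∈ H`. -/
def comul (g : ℕ) : TA g →ₗ[ℚ] TA g ⊗[ℚ] TA g :=
  (TensorAlgebra.lift ℚ
    (((TensorProduct.mk ℚ (TA g) (TA g)).flip 1) ∘ₗ TensorAlgebra.ι ℚ
      + (TensorProduct.mk ℚ (TA g) (TA g) 1) ∘ₗ TensorAlgebra.ι ℚ)).toLinearMap

/-- `T ⊗ T ⊗ T ⊗ T`. -/
abbrev T4 (g : ℕ) : Type := TA g ⊗[ℚ] (TA g ⊗[ℚ] (TA g ⊗[ℚ] TA g))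

/-- The generator `Θ(t,u,v,w)`, i.e. `t ⊗ u ⊗ v ⊗ w`. -/
def Th (g : ℕ) (t u v w : TA g) : T4 g := t ⊗ₜ[ℚ] (u ⊗ₜ[ℚ] (v ⊗ₜ[ℚ] w))

/-- The second term `Θ(t̄′, t″u, v̄′, wv″)` of the (GC3) relation
(Sweedler summation implicit). -/
def gc3B (g : ℕ) (t u v w : TA g) : T4 g :=
  (TensorProduct.assoc ℚ (TA g) (TA g) (TA g ⊗[ℚ] TA g))
    ((TensorProduct.map (barT g) (LinearMap.mulRight ℚ u)) (comul g t) ⊗ₜ[ℚ]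
     (TensorProduct.map (barT g) (LinearMap.mulLeft ℚ w)) (comul g v))

/-- The third term `Θ(tu″, ū′, w″v, w̄′)` of the (GC3) relation
(Sweedler summation implicit). -/
def gc3C (g : ℕ) (t u v w : TA g) : T4 g :=
  (TensorProduct.assoc ℚ (TA g) (TA g) (TA g ⊗[ℚ] TA g))
    ((TensorProduct.comm ℚ (TA g) (TA g)
        ((TensorProduct.map (barT g) (LinearMap.mulLeft ℚ t)) (comul g u))) ⊗ₜ[ℚ]
     (TensorProduct.comm ℚ (TA g) (TA g)
        ((TensorProduct.map (barT g) (LinearMap.mulRight ℚ v)) (comul g w))))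

/-- The full (GC3) element `Θ(t,u,v,w) + Θ(t̄′,t″u,v̄′,wv″) + Θ(tu″,ū′,w″v,w̄′)`. -/
def gc3 (g : ℕ) (t u v w : TA g) : T4 g :=
  Th g t u v w + gc3B g t u v w + gc3C g t u v w

/-- The relations (CS), (HB) and (GC3) defining `Ω̃₂`. -/
def OmegaRel (g : ℕ) : Set (T4 g) :=
  {x | (∃ t u v w : TA g,
          x = Th g t u v w - Th g (barT g v) (barT g w) (barT g t) (barT g u)) ∨
       (∃ t u v w : TA g,
          x = Th g t u v w - Th g (barT g u) (barT g t) (barT g w) (barT g v)) ∨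
       (∃ (t u v w : TA g) (a : Hsp g),
          x = Th g t u v (w * TensorAlgebra.ι ℚ a)
              - Th g t u (TensorAlgebra.ι ℚ a * v) w
              - Th g t (TensorAlgebra.ι ℚ a * u) v w
              + Th g (t * TensorAlgebra.ι ℚ a) u v w) ∨
       (∃ t u v w : TA g, x = gc3 g t u v w)}

/-- The 2-loop space `Ω̃₂`. -/
abbrev Omega2 (g : ℕ) : Type := T4 g ⧸ Submodule.span ℚ (OmegaRel g)

/-- The class `Θ(t,u,v,w) ∈ Ω̃₂`. -/
def ThO (g : ℕ) (t u v w : TA g) : Omega2 g := Submodule.Quotient.mk (Th g t u v w)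

/-- The presentation space for `C_{1,2}ℋ`: one copy of `T⊗T⊗T⊗T` for the theta
generators and one for the dumbbell generators. -/
abbrev P2 (g : ℕ) : Type := T4 g × T4 g

/-- The theta generator in the presentation space. -/
def ThP (g : ℕ) (t u v w : TA g) : P2 g := (Th g t u v w, 0)

/-- The dumbbell generator in the presentation space. -/
def DP (g : ℕ) (t u v w : TA g) : P2 g := (0, Th g t u v w)

/-- The relations (CS), (HB) and (CC) defining `C₁₂ = C_{1,2}ℋ`. -/
def C12Rel (g : ℕ) : Set (P2 g) :=
  {x | (∃ t u v w : TA g,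
          x = ThP g t u v w - ThP g (barT g v) (barT g w) (barT g t) (barT g u)) ∨
       (∃ t u v w : TA g,
          x = ThP g t u v w - ThP g (barT g u) (barT g t) (barT g w) (barT g v)) ∨
       (∃ t u v w : TA g,
          x = DP g t u v w - DP g (barT g v) u (barT g t) w) ∨
       (∃ t u v w : TA g,
          x = DP g t u v w - DP g (barT g u) (barT g t) (barT g w) (barT g v)) ∨
       (∃ (t u v w : TA g) (a : Hsp g),
          x = ThP g t u v (w * TensorAlgebra.ι ℚ a)
              - ThP g t u (TensorAlgebra.ι ℚ a * v) w
              - ThP g t (TensorAlgebra.ι ℚ a * u) v w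
              + ThP g (t * TensorAlgebra.ι ℚ a) u v w) ∨
       (∃ (t u v w : TA g) (a : Hsp g),
          x = DP g t u (TensorAlgebra.ι ℚ a * v) w
              - DP g (t * TensorAlgebra.ι ℚ a) u v w
              - DP g t u v (w * TensorAlgebra.ι ℚ a)
              + DP g t (TensorAlgebra.ι ℚ a * u) v w) ∨
       (∃ t u v w : TA g,
          x = DP g t u v w - ThP g t u v w - ThP g (barT g v) u (barT g t) w)}

/-- The space `C₁₂ = C_{1,2}ℋ`. -/
abbrev C12 (g : ℕ) : Type := P2 g ⧸ Submodule.span ℚ (C12Rel g)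

/-- The class `Θ(t,u,v,w) ∈ C₁₂`. -/
def ThC (g : ℕ) (t u v w : TA g) : C12 g := Submodule.Quotient.mk (ThP g t u v w)

/-- The class `D(t,u,v,w) ∈ C₁₂`. -/
def DC (g : ℕ) (t u v w : TA g) : C12 g := Submodule.Quotient.mk (DP g t u v w)

/-- The element `GC3(t,u,v,w) ∈ C₁₂`. -/
def gc3C12 (g : ℕ) (t u v w : TA g) : C12 g :=
  Submodule.Quotient.mk ((gc3 g t u v w, 0) : P2 g)

/-- The degree-`n` component `H^{⊗n}` of the tensor algebra. -/
def TAdeg (g n : ℕ) : Submodule ℚ (TA g) :=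
  (LinearMap.range (TensorAlgebra.ι ℚ : Hsp g →ₗ[ℚ] TA g)) ^ n

/-- The part of `T⊗T⊗T⊗T` of total tensor degree `m`. -/
def T4deg (g m : ℕ) : Submodule ℚ (T4 g) :=
  Submodule.span ℚ {x | ∃ i j k l : ℕ, i + j + k + l = m ∧
    ∃ t ∈ TAdeg g i, ∃ u ∈ TAdeg g j, ∃ v ∈ TAdeg g k, ∃ w ∈ TAdeg g l,
      x = Th g t u v w}

/-- The part `Ω̃₂^{(m)}` of total tensor degree `m`. -/
def Omega2deg (g m : ℕ) : Submodule ℚ (Omega2 g) :=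
  Submodule.map (Submodule.span ℚ (OmegaRel g)).mkQ (T4deg g m)

/-- The part `C₁₂^{(m)}` of total tensor degree `m` (Lie degree `n = m + 2`). -/
def C12deg (g m : ℕ) : Submodule ℚ (C12 g) :=
  Submodule.map (Submodule.span ℚ (C12Rel g)).mkQ ((T4deg g m).prod (T4deg g m))

/-- The functorial action of a linear endomorphism of `H` on the tensor algebra. -/
def TAmap (g : ℕ) (φ : Hsp g →ₗ[ℚ] Hsp g) : TA g →ₐ[ℚ] TA g :=
  TensorAlgebra.lift ℚ (TensorAlgebra.ι ℚ ∘ₗ φ)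

/-- The diagonal action on `T⊗T⊗T⊗T`. -/
def T4map (g : ℕ) (φ : Hsp g →ₗ[ℚ] Hsp g) : T4 g →ₗ[ℚ] T4 g :=
  TensorProduct.map (TAmap g φ).toLinearMap
    (TensorProduct.map (TAmap g φ).toLinearMap
      (TensorProduct.map (TAmap g φ).toLinearMap (TAmap g φ).toLinearMap))

/-- The diagonal action on the presentation space of `C₁₂`. -/
def P2map (g : ℕ) (φ : Hsp g →ₗ[ℚ] Hsp g) : P2 g →ₗ[ℚ] P2 g :=
  (T4map g φ).prodMap (T4map g φ)

/-- The action of `GL(H)` on polynomials, realizing `MvPolynomial (Fin 2g) ℚ` as the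
symmetric algebra `Sym H` via `eᵢ ↦ Xᵢ`. -/
def polyAct (g : ℕ) (σ : Hsp g ≃ₗ[ℚ] Hsp g) :
    MvPolynomial (Fin (2 * g)) ℚ →ₐ[ℚ] MvPolynomial (Fin (2 * g)) ℚ :=
  MvPolynomial.aeval fun i => ∑ j, MvPolynomial.C (σ (Pi.single i 1) j) * MvPolynomial.X j

/-- The `m`-th symmetric power `Sym^m H`, realized as the homogeneous polynomials of
degree `m`. -/
abbrev SymP (g m : ℕ) : Type := ↥(MvPolynomial.homogeneousSubmodule (Fin (2 * g)) ℚ m)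

/-- The space of `GL(H)`-equivariant linear maps `C₁₂^{(m)} → Λ^n H`. -/
def equivC12toLam (g m n : ℕ) :
    Submodule ℚ (↥(C12deg g m) →ₗ[ℚ] ↥(⋀[ℚ]^n (Hsp g))) where
  carrier := {π | ∀ (σ : Hsp g ≃ₗ[ℚ] Hsp g) (p : P2 g)
      (hx : Submodule.Quotient.mk p ∈ C12deg g m)
      (hy : Submodule.Quotient.mk (P2map g σ.toLinearMap p) ∈ C12deg g m),
      (↑(π ⟨Submodule.Quotient.mk (P2map g σ.toLinearMap p), hy⟩) :
          ExteriorAlgebra ℚ (Hsp g))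
        = ExteriorAlgebra.map σ.toLinearMap
            ↑(π ⟨Submodule.Quotient.mk p, hx⟩)}
  add_mem' := by
    intro f₁ f₂ h₁ h₂ σ p hx hy
    simp only [LinearMap.add_apply, Submodule.coe_add, h₁ σ p hx hy, h₂ σ p hx hy, map_add]
  zero_mem' := by
    intro σ p hx hy
    simp
  smul_mem' := by
    intro c f h σ p hx hy
    simp only [LinearMap.smul_apply, SetLike.val_smul, h σ p hx hy, map_smul]

/-- The space of `GL(H)`-equivariant linear maps `Ω̃₂^{(m)} → Λ^n H`. -/
def equivOmega2toLam (g m n : ℕ) :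
    Submodule ℚ (↥(Omega2deg g m) →ₗ[ℚ] ↥(⋀[ℚ]^n (Hsp g))) where
  carrier := {π | ∀ (σ : Hsp g ≃ₗ[ℚ] Hsp g) (x : T4 g)
      (hx : Submodule.Quotient.mk x ∈ Omega2deg g m)
      (hy : Submodule.Quotient.mk (T4map g σ.toLinearMap x) ∈ Omega2deg g m),
      (↑(π ⟨Submodule.Quotient.mk (T4map g σ.toLinearMap x), hy⟩) :
          ExteriorAlgebra ℚ (Hsp g))
        = ExteriorAlgebra.map σ.toLinearMap
            ↑(π ⟨Submodule.Quotient.mk x, hx⟩)}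
  add_mem' := by
    intro f₁ f₂ h₁ h₂ σ p hx hy
    simp only [LinearMap.add_apply, Submodule.coe_add, h₁ σ p hx hy, h₂ σ p hx hy, map_add]
  zero_mem' := by
    intro σ p hx hy
    simp
  smul_mem' := by
    intro c f h σ p hx hy
    simp only [LinearMap.smul_apply, SetLike.val_smul, h σ p hx hy, map_smul]

/-- The space of `GL(H)`-equivariant linear maps `C₁₂^{(m)} → Sym^n H`. -/
def equivC12toSym (g m n : ℕ) :
    Submodule ℚ (↥(C12deg g m) →ₗ[ℚ] SymP g n) where
  carrier := {π | ∀ (σ : Hsp g ≃ₗ[ℚ] Hsp g) (p : P2 g)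
      (hx : Submodule.Quotient.mk p ∈ C12deg g m)
      (hy : Submodule.Quotient.mk (P2map g σ.toLinearMap p) ∈ C12deg g m),
      (↑(π ⟨Submodule.Quotient.mk (P2map g σ.toLinearMap p), hy⟩) :
          MvPolynomial (Fin (2 * g)) ℚ)
        = polyAct g σ ↑(π ⟨Submodule.Quotient.mk p, hx⟩)}
  add_mem' := by
    intro f₁ f₂ h₁ h₂ σ p hx hy
    simp only [LinearMap.add_apply, Submodule.coe_add, h₁ σ p hx hy, h₂ σ p hx hy, map_add]
  zero_mem' := by
    intro σ p hx hy
    simp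
  smul_mem' := by
    intro c f h σ p hx hy
    simp only [LinearMap.smul_apply, SetLike.val_smul, h σ p hx hy, map_smul]

/-- The space of `GL(H)`-equivariant linear maps `Ω̃₂^{(m)} → Sym^n H`. -/
def equivOmega2toSym (g m n : ℕ) :
    Submodule ℚ (↥(Omega2deg g m) →ₗ[ℚ] SymP g n) where
  carrier := {π | ∀ (σ : Hsp g ≃ₗ[ℚ] Hsp g) (x : T4 g)
      (hx : Submodule.Quotient.mk x ∈ Omega2deg g m)
      (hy : Submodule.Quotient.mk (T4map g σ.toLinearMap x) ∈ Omega2deg g m),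
      (↑(π ⟨Submodule.Quotient.mk (T4map g σ.toLinearMap x), hy⟩) :
          MvPolynomial (Fin (2 * g)) ℚ)
        = polyAct g σ ↑(π ⟨Submodule.Quotient.mk x, hx⟩)}
  add_mem' := by
    intro f₁ f₂ h₁ h₂ σ p hx hy
    simp only [LinearMap.add_apply, Submodule.coe_add, h₁ σ p hx hy, h₂ σ p hx hy, map_add]
  zero_mem' := by
    intro σ p hx hy
    simp
  smul_mem' := by
    intro c f h σ p hx hy
    simp only [LinearMap.smul_apply, SetLike.val_smul, h σ p hx hy, map_smul]

/-- A vector of `H`, seen as a linear form in the polynomial model of `Sym H`. -/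
def linForm (g : ℕ) : Hsp g →ₗ[ℚ] MvPolynomial (Fin (2 * g)) ℚ :=
  Fintype.linearCombination ℚ MvPolynomial.X

/-- The algebra map `T → Sym(H)[z]` sending `a ∈ H` to `s z a`. -/
def slotEval (g : ℕ) (s : ℚ) : TA g →ₐ[ℚ] Polynomial (MvPolynomial (Fin (2 * g)) ℚ) :=
  TensorAlgebra.lift ℚ (s • ((Polynomial.monomial 1).restrictScalars ℚ ∘ₗ linForm g))

/-- The algebra map `T ⊗ T ⊗ T ⊗ T → Sym(H)[z]` applying `slotEval` with weights
`a, b, c, d` in the four slots. -/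
def fourEval (g : ℕ) (a b c d : ℚ) :
    T4 g →ₐ[ℚ] Polynomial (MvPolynomial (Fin (2 * g)) ℚ) :=
  Algebra.TensorProduct.productMap (slotEval g a)
    (Algebra.TensorProduct.productMap (slotEval g b)
      (Algebra.TensorProduct.productMap (slotEval g c) (slotEval g d)))

/-- The quadratic part of `fourEval`. -/
def quadEval (g : ℕ) (a b c d : ℚ) : T4 g →ₗ[ℚ] MvPolynomial (Fin (2 * g)) ℚ :=
  (Polynomial.lcoeff (MvPolynomial (Fin (2 * g)) ℚ) 2).restrictScalars ℚ ∘ₗ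
    (fourEval g a b c d).toLinearMap

section Evaluation

variable {g : ℕ}

@[simp]
lemma slotEval_ι (s : ℚ) (a : Hsp g) :
    slotEval g s (TensorAlgebra.ι ℚ a) = s • Polynomial.monomial 1 (linForm g a) := by
  simp [slotEval]

lemma fourEval_Th (a b c d : ℚ) (t u v w : TA g) :
    fourEval g a b c d (Th g t u v w) =
      slotEval g a t * (slotEval g b u * (slotEval g c v * slotEval g d w)) := by
  simp [fourEval, Th]

lemma quadEval_apply (a b c d : ℚ) (x : T4 g) :
    quadEval g a b c d x = (fourEval g a b c d x).coeff 2 := rfl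

@[simp]
lemma barT_one : barT g 1 = 1 := by simp [barT]

@[simp]
lemma barT_ι (a : Hsp g) : barT g (TensorAlgebra.ι ℚ a) = -TensorAlgebra.ι ℚ a := by
  simp [barT]

@[simp]
lemma barT_mul (x y : TA g) : barT g (x * y) = barT g y * barT g x := by simp [barT]

@[simp]
lemma barT_algebraMap (r : ℚ) : barT g (algebraMap ℚ (TA g) r) = algebraMap ℚ (TA g) r := by
  simp [Algebra.algebraMap_eq_smul_one]

@[simp]
lemma slotEval_barT (s : ℚ) (t : TA g) : slotEval g s (barT g t) = slotEval g (-s) t := by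
  induction t using TensorAlgebra.induction with
  | algebraMap r => simp
  | ι a => simp
  | mul x y hx hy => simp [hx, hy, mul_comm]
  | add x y hx hy => simp [hx, hy]

lemma comul_one : comul g 1 = 1 ⊗ₜ[ℚ] 1 := by
  simp [comul, Algebra.TensorProduct.one_def]

lemma comul_ι (a : Hsp g) :
    comul g (TensorAlgebra.ι ℚ a) =
      TensorAlgebra.ι ℚ a ⊗ₜ[ℚ] 1 + 1 ⊗ₜ[ℚ] TensorAlgebra.ι ℚ a := by
  simp [comul]

lemma slotEval_comul (a b : ℚ) (t : TA g) :
    Algebra.TensorProduct.productMap (slotEval g a) (slotEval g b) (comul g t) =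
      slotEval g (a + b) t := by
  induction t using TensorAlgebra.induction with
  | algebraMap r => simp [comul]
  | ι x => simp [comul_ι, add_smul]
  | mul x y hx hy =>
    have h : comul g (x * y) = comul g x * comul g y := by simp [comul]
    rw [h, map_mul, hx, hy, map_mul]
  | add x y hx hy => simp only [map_add, hx, hy]

lemma slotEval_bar_mulRight (a b : ℚ) (t u : TA g) :
    Algebra.TensorProduct.productMap (slotEval g a) (slotEval g b)
        (TensorProduct.map (barT g) (LinearMap.mulRight ℚ u) (comul g t)) =
      slotEval g (b - a) t * slotEval g b u := by
  have h (z : TA g ⊗[ℚ] TA g) :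
      Algebra.TensorProduct.productMap (slotEval g a) (slotEval g b)
        (TensorProduct.map (barT g) (LinearMap.mulRight ℚ u) z) =
      Algebra.TensorProduct.productMap (slotEval g (-a)) (slotEval g b) z * slotEval g b u := by
    induction z with
    | zero => simp
    | tmul x y => simp [mul_assoc]
    | add x y hx hy => simp only [map_add, hx, hy, add_mul]
  rw [h, slotEval_comul, neg_add_eq_sub]

lemma slotEval_bar_mulLeft (a b : ℚ) (t u : TA g) :
    Algebra.TensorProduct.productMap (slotEval g a) (slotEval g b)
        (TensorProduct.map (barT g) (LinearMap.mulLeft ℚ u) (comul g t)) =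
      slotEval g (b - a) t * slotEval g b u := by
  have h (z : TA g ⊗[ℚ] TA g) :
      Algebra.TensorProduct.productMap (slotEval g a) (slotEval g b)
        (TensorProduct.map (barT g) (LinearMap.mulLeft ℚ u) z) =
      Algebra.TensorProduct.productMap (slotEval g (-a)) (slotEval g b) z * slotEval g b u := by
    induction z with
    | zero => simp
    | tmul x y => simp only [TensorProduct.map_tmul, LinearMap.mulLeft_apply,
        Algebra.TensorProduct.productMap_apply_tmul, slotEval_barT, map_mul]; ring
    | add x y hx hy => simp only [map_add, hx, hy, add_mul]
  rw [h, slotEval_comul, neg_add_eq_sub]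

lemma productMap_comm (a b : ℚ) (z : TA g ⊗[ℚ] TA g) :
    Algebra.TensorProduct.productMap (slotEval g a) (slotEval g b)
        (TensorProduct.comm ℚ (TA g) (TA g) z) =
      Algebra.TensorProduct.productMap (slotEval g b) (slotEval g a) z := by
  induction z with
  | zero => simp
  | tmul x y => simp [mul_comm]
  | add x y hx hy => simp only [map_add, hx, hy]

lemma fourEval_assoc (a b c d : ℚ) (x y : TA g ⊗[ℚ] TA g) :
    fourEval g a b c d (TensorProduct.assoc ℚ (TA g) (TA g) (TA g ⊗[ℚ] TA g) (x ⊗ₜ[ℚ] y)) =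
      Algebra.TensorProduct.productMap (slotEval g a) (slotEval g b) x *
        Algebra.TensorProduct.productMap (slotEval g c) (slotEval g d) y := by
  induction x using TensorProduct.induction_on with
  | zero => simp
  | tmul p q => simp [fourEval, mul_assoc]
  | add p q hp hq => simp only [TensorProduct.add_tmul, map_add, hp, hq, add_mul]

lemma fourEval_gc3B (a b c d : ℚ) (t u v w : TA g) :
    fourEval g a b c d (gc3B g t u v w) = fourEval g (b - a) b (d - c) d (Th g t u v w) := by
  rw [gc3B, fourEval_assoc, slotEval_bar_mulRight, slotEval_bar_mulLeft, fourEval_Th]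
  ring

lemma fourEval_gc3C (a b c d : ℚ) (t u v w : TA g) :
    fourEval g a b c d (gc3C g t u v w) = fourEval g a (a - b) c (c - d) (Th g t u v w) := by
  rw [gc3C, fourEval_assoc, productMap_comm, productMap_comm, slotEval_bar_mulRight,
    slotEval_bar_mulLeft, fourEval_Th]
  ring

lemma slotEval_coeff (s : ℚ) (t : TA g) (n : ℕ) :
    (slotEval g s t).coeff n = (slotEval g 1 t).coeff n * (MvPolynomial.C s) ^ n := by
  have h : slotEval g s = ((Polynomial.aeval (R := MvPolynomial (Fin (2 * g)) ℚ)
      (Polynomial.C (MvPolynomial.C s) * Polynomial.X)).restrictScalars ℚ).comp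
        (slotEval g 1) := by
    refine TensorAlgebra.hom_ext (LinearMap.ext fun a => ?_)
    change slotEval g s (TensorAlgebra.ι ℚ a) =
      Polynomial.aeval _ (slotEval g 1 (TensorAlgebra.ι ℚ a))
    rw [slotEval_ι, slotEval_ι, one_smul, Polynomial.aeval_monomial, pow_one,
      ← Polynomial.C_mul_X_eq_monomial, Algebra.smul_def, Polynomial.algebraMap_apply,
      Polynomial.algebraMap_apply, MvPolynomial.algebraMap_eq, Algebra.algebraMap_self_apply]
    ring
  rw [h]
  exact Polynomial.comp_C_mul_X_coeff

/-- The quadratic part depends on the weights as a quadratic form. -/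
lemma quadEval_Th (a b c d : ℚ) (t u v w : TA g) :
    quadEval g a b c d (Th g t u v w) =
      let t₀ := (slotEval g 1 t).coeff
      let u₀ := (slotEval g 1 u).coeff
      let v₀ := (slotEval g 1 v).coeff
      let w₀ := (slotEval g 1 w).coeff
      MvPolynomial.C (a * a) * (t₀ 2 * u₀ 0 * v₀ 0 * w₀ 0) +
      MvPolynomial.C (b * b) * (t₀ 0 * u₀ 2 * v₀ 0 * w₀ 0) +
      MvPolynomial.C (c * c) * (t₀ 0 * u₀ 0 * v₀ 2 * w₀ 0) +
      MvPolynomial.C (d * d) * (t₀ 0 * u₀ 0 * v₀ 0 * w₀ 2) +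
      MvPolynomial.C (a * b) * (t₀ 1 * u₀ 1 * v₀ 0 * w₀ 0) +
      MvPolynomial.C (a * c) * (t₀ 1 * u₀ 0 * v₀ 1 * w₀ 0) +
      MvPolynomial.C (a * d) * (t₀ 1 * u₀ 0 * v₀ 0 * w₀ 1) +
      MvPolynomial.C (b * c) * (t₀ 0 * u₀ 1 * v₀ 1 * w₀ 0) +
      MvPolynomial.C (b * d) * (t₀ 0 * u₀ 1 * v₀ 0 * w₀ 1) +
      MvPolynomial.C (c * d) * (t₀ 0 * u₀ 0 * v₀ 1 * w₀ 1) := by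
  simp only [quadEval_apply, fourEval_Th, Polynomial.coeff_mul,
    Finset.Nat.antidiagonal_succ, Finset.Nat.antidiagonal_zero, Finset.sum_cons,
    Finset.map_singleton, Finset.sum_singleton, Finset.map_cons, Function.Embedding.prodMap,
    Function.Embedding.coeFn_mk, Prod.map, Function.Embedding.refl_apply, Nat.succ_eq_add_one,
    zero_add, Nat.reduceAdd, slotEval_coeff a, slotEval_coeff b, slotEval_coeff c,
    slotEval_coeff d, map_mul]
  ring

lemma quadEval_neg (a b c d : ℚ) (t u v w : TA g) :
    quadEval g (-a) (-b) (-c) (-d) (Th g t u v w) = quadEval g a b c d (Th g t u v w) := by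
  simp only [quadEval_Th, neg_mul_neg]

lemma quadEval_barT_slots (a b c d : ℚ) (t u v w : TA g) :
    quadEval g a b c d (Th g (barT g v) (barT g w) (barT g t) (barT g u)) =
      quadEval g c d a b (Th g t u v w) := by
  rw [← quadEval_neg]
  simp only [quadEval_apply, fourEval_Th, slotEval_barT, neg_neg]
  congr 1
  ring

lemma quadEval_barT_sides (a b c d : ℚ) (t u v w : TA g) :
    quadEval g a b c d (Th g (barT g u) (barT g t) (barT g w) (barT g v)) =
      quadEval g b a d c (Th g t u v w) := by
  rw [← quadEval_neg]
  simp only [quadEval_apply, fourEval_Th, slotEval_barT, neg_neg]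
  congr 1
  ring

lemma quadEval_barT_exchange (a b c d : ℚ) (t u v w : TA g) :
    quadEval g a b c d (Th g (barT g v) u (barT g t) w) =
      quadEval g (-c) b (-a) d (Th g t u v w) := by
  simp only [quadEval_apply, fourEval_Th, slotEval_barT]
  congr 1
  ring

/-- The hair-sliding relation is killed by weights with `a + d = b + c`. -/
lemma quadEval_hair {a b c d : ℚ} (h : a + d = b + c) (t u v w : TA g) (x : Hsp g) :
    quadEval g a b c d (Th g t u v (w * TensorAlgebra.ι ℚ x))
      - quadEval g a b c d (Th g t u (TensorAlgebra.ι ℚ x * v) w)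
      - quadEval g a b c d (Th g t (TensorAlgebra.ι ℚ x * u) v w)
      + quadEval g a b c d (Th g (t * TensorAlgebra.ι ℚ x) u v w) = 0 := by
  obtain rfl : d = b + c - a := by linarith
  simp only [quadEval_apply, fourEval_Th, map_mul, slotEval_ι, ← Polynomial.coeff_sub,
    ← Polynomial.coeff_add]
  convert Polynomial.coeff_zero 2
  simp only [Algebra.smul_def, map_add, map_sub]
  ring

lemma quadEval_gc3 (a b c d : ℚ) (t u v w : TA g) :
    quadEval g a b c d (gc3 g t u v w) = quadEval g a b c d (Th g t u v w) +
      quadEval g (b - a) b (d - c) d (Th g t u v w) +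
      quadEval g a (a - b) c (c - d) (Th g t u v w) := by
  simp only [gc3, map_add, quadEval_apply, fourEval_gc3B, fourEval_gc3C]

lemma linForm_apply (x : Hsp g) : linForm g x = ∑ i, x i • MvPolynomial.X i := by
  simp [linForm, Fintype.linearCombination_apply]

lemma linForm_isHomogeneous (x : Hsp g) : (linForm g x).IsHomogeneous 1 := by
  rw [linForm_apply]
  refine MvPolynomial.IsHomogeneous.sum _ _ _ fun i _ => ?_
  rw [MvPolynomial.smul_eq_C_mul]
  simpa using (MvPolynomial.isHomogeneous_C _ _).mul (MvPolynomial.isHomogeneous_X ℚ i)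

lemma coeff_mul_isHomogeneous {p q : Polynomial (MvPolynomial (Fin (2 * g)) ℚ)}
    (hp : ∀ n, (p.coeff n).IsHomogeneous n) (hq : ∀ n, (q.coeff n).IsHomogeneous n) (n : ℕ) :
    ((p * q).coeff n).IsHomogeneous n := by
  rw [Polynomial.coeff_mul]
  refine MvPolynomial.IsHomogeneous.sum _ _ _ fun i hi => ?_
  rw [← Finset.HasAntidiagonal.mem_antidiagonal.mp hi]
  exact (hp _).mul (hq _)

lemma slotEval_isHomogeneous (s : ℚ) (t : TA g) (n : ℕ) :
    ((slotEval g s t).coeff n).IsHomogeneous n := by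
  induction t using TensorAlgebra.induction generalizing n with
  | algebraMap r =>
    rw [AlgHom.commutes, Polynomial.algebraMap_apply, Polynomial.coeff_C]
    split_ifs with h
    · exact h ▸ MvPolynomial.isHomogeneous_C _ _
    · exact MvPolynomial.isHomogeneous_zero _ _ _
  | ι a =>
    rw [slotEval_ι, Polynomial.coeff_smul, Polynomial.coeff_monomial]
    refine (MvPolynomial.homogeneousSubmodule _ _ n).smul_mem _ ?_
    split_ifs with h
    · exact h ▸ linForm_isHomogeneous a
    · exact Submodule.zero_mem _
  | mul x y hx hy => rw [map_mul]; exact coeff_mul_isHomogeneous hx hy n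
  | add x y hx hy => rw [map_add, Polynomial.coeff_add]; exact (hx n).add (hy n)

@[elab_as_elim]
lemma T4_induction {P : T4 g → Prop} (x : T4 g) (hTh : ∀ t u v w, P (Th g t u v w))
    (hadd : ∀ x y, P x → P y → P (x + y)) : P x := by
  have h0 : P 0 := by simpa [Th] using hTh 0 0 0 0
  induction x using TensorProduct.induction_on with
  | zero => exact h0
  | add x y hx hy => exact hadd x y hx hy
  | tmul t y =>
    induction y using TensorProduct.induction_on with
    | zero => simpa using h0
    | add x y hx hy => rw [TensorProduct.tmul_add]; exact hadd _ _ hx hy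
    | tmul u y =>
      induction y using TensorProduct.induction_on with
      | zero => simpa using h0
      | add x y hx hy =>
        rw [TensorProduct.tmul_add, TensorProduct.tmul_add]
        exact hadd _ _ hx hy
      | tmul v w => exact hTh t u v w

lemma quadEval_mem (a b c d : ℚ) (x : T4 g) :
    quadEval g a b c d x ∈ MvPolynomial.homogeneousSubmodule (Fin (2 * g)) ℚ 2 := by
  induction x using T4_induction with
  | hTh t u v w =>
    rw [quadEval_apply, fourEval_Th]
    exact coeff_mul_isHomogeneous (slotEval_isHomogeneous a t)
      (coeff_mul_isHomogeneous (slotEval_isHomogeneous b u)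
        (coeff_mul_isHomogeneous (slotEval_isHomogeneous c v) (slotEval_isHomogeneous d w))) 2
  | hadd x y hx hy => rw [map_add]; exact Submodule.add_mem _ hx hy

lemma polyAct_linForm (σ : Hsp g ≃ₗ[ℚ] Hsp g) (x : Hsp g) :
    polyAct g σ (linForm g x) = linForm g (σ x) := by
  suffices h : (polyAct g σ).toLinearMap ∘ₗ linForm g = linForm g ∘ₗ σ.toLinearMap from
    LinearMap.congr_fun h x
  refine (Pi.basisFun ℚ (Fin (2 * g))).ext fun i => ?_
  simp [linForm_apply, polyAct, MvPolynomial.smul_eq_C_mul, Pi.single_apply]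

lemma slotEval_TAmap (s : ℚ) (σ : Hsp g ≃ₗ[ℚ] Hsp g) (t : TA g) :
    slotEval g s (TAmap g σ.toLinearMap t) =
      Polynomial.mapAlgHom (polyAct g σ) (slotEval g s t) := by
  suffices h : (slotEval g s).comp (TAmap g σ.toLinearMap) =
      (Polynomial.mapAlgHom (polyAct g σ)).comp (slotEval g s) from DFunLike.congr_fun h t
  apply TensorAlgebra.hom_ext
  refine LinearMap.ext fun a => ?_
  have h : slotEval g s (TAmap g σ.toLinearMap (TensorAlgebra.ι ℚ a)) =
      s • Polynomial.monomial 1 (linForm g (σ a)) := by simp [TAmap]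
  have h' : Polynomial.mapAlgHom (polyAct g σ) (slotEval g s (TensorAlgebra.ι ℚ a)) =
      s • Polynomial.monomial 1 (linForm g (σ a)) := by
    rw [slotEval_ι, map_smul, Polynomial.coe_mapAlgHom, Polynomial.map_monomial]
    exact congrArg (fun p => s • Polynomial.monomial 1 p) (polyAct_linForm σ a)
  exact h.trans h'.symm

lemma quadEval_T4map (a b c d : ℚ) (σ : Hsp g ≃ₗ[ℚ] Hsp g) (x : T4 g) :
    quadEval g a b c d (T4map g σ.toLinearMap x) = polyAct g σ (quadEval g a b c d x) := by
  induction x using T4_induction with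
  | hTh t u v w =>
    have h : T4map g σ.toLinearMap (Th g t u v w) = Th g (TAmap g σ.toLinearMap t)
      (TAmap g σ.toLinearMap u) (TAmap g σ.toLinearMap v) (TAmap g σ.toLinearMap w) := rfl
    simp only [h, quadEval_apply, fourEval_Th, slotEval_TAmap, ← map_mul]
    exact Polynomial.coeff_map _ _
  | hadd x y hx hy => simp only [map_add, hx, hy]

end Evaluation

section PolynomialSection

variable {g : ℕ} {V W : Type*} [AddCommGroup V] [Module ℚ V] [AddCommGroup W] [Module ℚ W]

/-- The linear map on polynomials which, for symmetric `B`, sends the product of the linear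
forms of `a` and `b` to `B a b`. -/
def polySection (B : Hsp g →ₗ[ℚ] Hsp g →ₗ[ℚ] V) : MvPolynomial (Fin (2 * g)) ℚ →ₗ[ℚ] V where
  toFun p := ∑ i, ∑ j,
    ((1 / 2 : ℚ) * MvPolynomial.constantCoeff (MvPolynomial.pderiv i (MvPolynomial.pderiv j p))) •
      B (Pi.single i 1) (Pi.single j 1)
  map_add' p q := by simp only [map_add, mul_add, add_smul, Finset.sum_add_distrib]
  map_smul' c p := by
    simp only [Derivation.map_smul, MvPolynomial.constantCoeff_smul, smul_eq_mul,
      RingHom.id_apply, Finset.smul_sum, smul_smul, mul_left_comm]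

lemma polySection_apply (B : Hsp g →ₗ[ℚ] Hsp g →ₗ[ℚ] V) (p : MvPolynomial (Fin (2 * g)) ℚ) :
    polySection B p = ∑ i, ∑ j,
      ((1 / 2 : ℚ) *
        MvPolynomial.constantCoeff (MvPolynomial.pderiv i (MvPolynomial.pderiv j p))) •
          B (Pi.single i 1) (Pi.single j 1) := rfl

lemma pderiv_linForm (i : Fin (2 * g)) (x : Hsp g) :
    MvPolynomial.pderiv i (linForm g x) = MvPolynomial.C (x i) := by
  simp [linForm_apply, MvPolynomial.pderiv_X, Pi.single_apply, MvPolynomial.smul_eq_C_mul]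

lemma bilin_eq_sum (B : Hsp g →ₗ[ℚ] Hsp g →ₗ[ℚ] V) (a b : Hsp g) :
    B a b = ∑ i, ∑ j, (a i * b j) • B (Pi.single i 1) (Pi.single j 1) := by
  conv_lhs => rw [pi_eq_sum_univ' a, pi_eq_sum_univ' b]
  simp only [map_sum, LinearMap.sum_apply, map_smul, LinearMap.smul_apply, Finset.smul_sum,
    smul_smul]
  rw [Finset.sum_comm]
  simp only [mul_comm]

lemma polySection_mul (B : Hsp g →ₗ[ℚ] Hsp g →ₗ[ℚ] V) (hB : ∀ a b, B a b = B b a)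
    (a b : Hsp g) : polySection B (linForm g a * linForm g b) = B a b := by
  have h : polySection B (linForm g a * linForm g b) = (1 / 2 : ℚ) • (B a b + B b a) := by
    rw [bilin_eq_sum B a b, bilin_eq_sum B b a, polySection_apply]
    simp only [← Finset.sum_add_distrib, Finset.smul_sum, ← add_smul, smul_smul]
    refine Finset.sum_congr rfl fun i _ => Finset.sum_congr rfl fun j _ => ?_
    congr 2
    simp [Derivation.leibniz, pderiv_linForm]
    ring
  rw [h, hB b a]
  module

lemma map_polySection (B : Hsp g →ₗ[ℚ] Hsp g →ₗ[ℚ] V) (L : V →ₗ[ℚ] W)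
    (p : MvPolynomial (Fin (2 * g)) ℚ) :
    L (polySection B p) = polySection (B.compr₂ L) p := by
  simp [polySection_apply]

lemma polySection_mem (B : Hsp g →ₗ[ℚ] Hsp g →ₗ[ℚ] V) (N : Submodule ℚ V)
    (h : ∀ a b, B a b ∈ N) (p : MvPolynomial (Fin (2 * g)) ℚ) : polySection B p ∈ N := by
  rw [polySection_apply]
  exact N.sum_mem fun _ _ => N.sum_mem fun _ _ => N.smul_mem _ (h _ _)

/-- The product of linear forms. -/
def linFormMul (g : ℕ) : Hsp g →ₗ[ℚ] Hsp g →ₗ[ℚ] MvPolynomial (Fin (2 * g)) ℚ :=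
  (LinearMap.mul ℚ (MvPolynomial (Fin (2 * g)) ℚ)).compl₁₂ (linForm g) (linForm g)

lemma linFormMul_apply (a b : Hsp g) : linFormMul g a b = linForm g a * linForm g b := rfl

lemma polySection_linFormMul {p : MvPolynomial (Fin (2 * g)) ℚ}
    (hp : p ∈ MvPolynomial.homogeneousSubmodule (Fin (2 * g)) ℚ 2) :
    polySection (linFormMul g) p = p := by
  rw [← MvPolynomial.homogeneousSubmodule_one_pow, pow_two,
    MvPolynomial.homogeneousSubmodule_one_eq_span_X] at hp
  induction hp using Submodule.mul_induction_on' with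
  | mem_mul_mem x hx y hy =>
    obtain ⟨a, rfl⟩ := (Submodule.mem_span_range_iff_exists_fun ℚ).mp hx
    obtain ⟨b, rfl⟩ := (Submodule.mem_span_range_iff_exists_fun ℚ).mp hy
    rw [← linForm_apply, ← linForm_apply,
      polySection_mul _ fun a b => by simp only [linFormMul_apply, mul_comm]]
    rfl
  | add x hx y hy ihx ihy => rw [map_add, ihx, ihy]

end PolynomialSection

section ThetaInvariance

variable {g : ℕ} {V W : Type*} [AddCommGroup V] [Module ℚ V] [AddCommGroup W] [Module ℚ W]

/-- A linear map on `T ⊗ T ⊗ T ⊗ T` respecting the relations (CS) and (HB) for theta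
generators. -/
structure IsThetaInvariant (L : T4 g →ₗ[ℚ] V) : Prop where
  slots : ∀ t u v w, L (Th g (barT g v) (barT g w) (barT g t) (barT g u)) = L (Th g t u v w)
  sides : ∀ t u v w, L (Th g (barT g u) (barT g t) (barT g w) (barT g v)) = L (Th g t u v w)
  hair : ∀ t u v w (a : Hsp g),
    L (Th g t u v (w * TensorAlgebra.ι ℚ a)) - L (Th g t u (TensorAlgebra.ι ℚ a * v) w)
      - L (Th g t (TensorAlgebra.ι ℚ a * u) v w) + L (Th g (t * TensorAlgebra.ι ℚ a) u v w) = 0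

lemma IsThetaInvariant.comp {L : T4 g →ₗ[ℚ] V} (hL : IsThetaInvariant L) (K : V →ₗ[ℚ] W) :
    IsThetaInvariant (K ∘ₗ L) where
  slots t u v w := congrArg K (hL.slots t u v w)
  sides t u v w := congrArg K (hL.sides t u v w)
  hair t u v w a := by simpa using congrArg K (hL.hair t u v w a)

lemma IsThetaInvariant.prod {L : T4 g →ₗ[ℚ] V} {K : T4 g →ₗ[ℚ] W} (hL : IsThetaInvariant L)
    (hK : IsThetaInvariant K) : IsThetaInvariant (L.prod K) where
  slots t u v w := Prod.ext (hL.slots t u v w) (hK.slots t u v w)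
  sides t u v w := Prod.ext (hL.sides t u v w) (hK.sides t u v w)
  hair t u v w a := Prod.ext (hL.hair t u v w a) (hK.hair t u v w a)

lemma Th_add₁ (t t' u v w : TA g) : Th g (t + t') u v w = Th g t u v w + Th g t' u v w := by
  simp [Th, TensorProduct.add_tmul]

lemma Th_add₂ (t u u' v w : TA g) : Th g t (u + u') v w = Th g t u v w + Th g t u' v w := by
  simp [Th, TensorProduct.add_tmul, TensorProduct.tmul_add]

lemma Th_add₃ (t u v v' w : TA g) : Th g t u (v + v') w = Th g t u v w + Th g t u v' w := by
  simp [Th, TensorProduct.add_tmul, TensorProduct.tmul_add]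

lemma Th_add₄ (t u v w w' : TA g) : Th g t u v (w + w') = Th g t u v w + Th g t u v w' := by
  simp [Th, TensorProduct.tmul_add]

lemma Th_smul₁ (c : ℚ) (t u v w : TA g) : Th g (c • t) u v w = c • Th g t u v w := rfl

lemma Th_smul₂ (c : ℚ) (t u v w : TA g) : Th g t (c • u) v w = c • Th g t u v w := by
  rw [Th, ← TensorProduct.smul_tmul', TensorProduct.tmul_smul]; rfl

lemma Th_smul₃ (c : ℚ) (t u v w : TA g) : Th g t u (c • v) w = c • Th g t u v w := by
  rw [Th, ← TensorProduct.smul_tmul', TensorProduct.tmul_smul, TensorProduct.tmul_smul]; rfl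

lemma Th_smul₄ (c : ℚ) (t u v w : TA g) : Th g t u v (c • w) = c • Th g t u v w := by
  simp [Th, TensorProduct.tmul_smul]

lemma Th_neg₁ (t u v w : TA g) : Th g (-t) u v w = -Th g t u v w := by
  simpa using Th_smul₁ (-1) t u v w

lemma Th_neg₂ (t u v w : TA g) : Th g t (-u) v w = -Th g t u v w := by
  simpa using Th_smul₂ (-1) t u v w

lemma Th_neg₃ (t u v w : TA g) : Th g t u (-v) w = -Th g t u v w := by
  simpa using Th_smul₃ (-1) t u v w

lemma Th_neg₄ (t u v w : TA g) : Th g t u v (-w) = -Th g t u v w := by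
  simpa using Th_smul₄ (-1) t u v w

/-- `L (Θ(ab,1,1,1))` as a bilinear map in `a, b`. -/
def sameSlot (L : T4 g →ₗ[ℚ] V) : Hsp g →ₗ[ℚ] Hsp g →ₗ[ℚ] V :=
  LinearMap.mk₂ ℚ (fun a b => L (Th g (TensorAlgebra.ι ℚ a * TensorAlgebra.ι ℚ b) 1 1 1))
    (fun a a' b => by simp only [map_add, add_mul, Th_add₁])
    (fun c a b => by simp only [map_smul, smul_mul_assoc, Th_smul₁])
    (fun a b b' => by simp only [map_add, mul_add, Th_add₁])
    (fun c a b => by simp only [map_smul, mul_smul_comm, Th_smul₁])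

/-- `L (Θ(a,b,1,1))` as a bilinear map in `a, b`. -/
def sideSlots (L : T4 g →ₗ[ℚ] V) : Hsp g →ₗ[ℚ] Hsp g →ₗ[ℚ] V :=
  LinearMap.mk₂ ℚ (fun a b => L (Th g (TensorAlgebra.ι ℚ a) (TensorAlgebra.ι ℚ b) 1 1))
    (fun a a' b => by simp only [map_add, Th_add₁])
    (fun c a b => by simp only [map_smul, Th_smul₁])
    (fun a b b' => by simp only [map_add, Th_add₂])
    (fun c a b => by simp only [map_smul, Th_smul₂])

/-- `L (Θ(a,1,b,1))` as a bilinear map in `a, b`. -/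
def crossSlots (L : T4 g →ₗ[ℚ] V) : Hsp g →ₗ[ℚ] Hsp g →ₗ[ℚ] V :=
  LinearMap.mk₂ ℚ (fun a b => L (Th g (TensorAlgebra.ι ℚ a) 1 (TensorAlgebra.ι ℚ b) 1))
    (fun a a' b => by simp only [map_add, Th_add₁])
    (fun c a b => by simp only [map_smul, Th_smul₁])
    (fun a b b' => by simp only [map_add, Th_add₃])
    (fun c a b => by simp only [map_smul, Th_smul₃])

lemma sameSlot_apply (L : T4 g →ₗ[ℚ] V) (a b : Hsp g) :
    sameSlot L a b = L (Th g (TensorAlgebra.ι ℚ a * TensorAlgebra.ι ℚ b) 1 1 1) := rfl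

lemma sideSlots_apply (L : T4 g →ₗ[ℚ] V) (a b : Hsp g) :
    sideSlots L a b = L (Th g (TensorAlgebra.ι ℚ a) (TensorAlgebra.ι ℚ b) 1 1) := rfl

lemma crossSlots_apply (L : T4 g →ₗ[ℚ] V) (a b : Hsp g) :
    crossSlots L a b = L (Th g (TensorAlgebra.ι ℚ a) 1 (TensorAlgebra.ι ℚ b) 1) := rfl

lemma IsThetaInvariant.sideSlots_symm {L : T4 g →ₗ[ℚ] V} (hL : IsThetaInvariant L)
    (a b : Hsp g) : sideSlots L a b = sideSlots L b a := by
  simpa [sideSlots_apply, Th_neg₁, Th_neg₂] using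
    hL.sides (TensorAlgebra.ι ℚ b) (TensorAlgebra.ι ℚ a) 1 1

lemma IsThetaInvariant.crossSlots_symm {L : T4 g →ₗ[ℚ] V} (hL : IsThetaInvariant L)
    (a b : Hsp g) : crossSlots L a b = crossSlots L b a := by
  simpa [crossSlots_apply, Th_neg₁, Th_neg₃] using
    hL.slots (TensorAlgebra.ι ℚ b) 1 (TensorAlgebra.ι ℚ a) 1

/-- The values of a theta-invariant map on `Θ(a,1,1,b)`. -/
lemma IsThetaInvariant.outerSlots_eq {L : T4 g →ₗ[ℚ] V} (hL : IsThetaInvariant L)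
    (a b : Hsp g) : L (Th g (TensorAlgebra.ι ℚ a) 1 1 (TensorAlgebra.ι ℚ b)) =
      sideSlots L a b + crossSlots L a b - sameSlot L a b := by
  have h := hL.hair (TensorAlgebra.ι ℚ a) 1 1 1 b
  rw [one_mul, mul_one] at h
  rw [sideSlots_apply, crossSlots_apply, sameSlot_apply, ← sub_eq_zero, ← h]
  abel

/-- The values of a theta-invariant map on `Θ(1,b,a,1)`. -/
lemma IsThetaInvariant.innerSlots_eq {L : T4 g →ₗ[ℚ] V} (hL : IsThetaInvariant L)
    (a b : Hsp g) : L (Th g 1 (TensorAlgebra.ι ℚ b) (TensorAlgebra.ι ℚ a) 1) =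
      L (Th g (TensorAlgebra.ι ℚ a) 1 1 (TensorAlgebra.ι ℚ b)) := by
  simpa [Th_neg₁, Th_neg₂, Th_neg₃, Th_neg₄] using
    hL.slots (TensorAlgebra.ι ℚ a) 1 1 (TensorAlgebra.ι ℚ b)

lemma IsThetaInvariant.sameSlot_symm {L : T4 g →ₗ[ℚ] V} (hL : IsThetaInvariant L)
    (a b : Hsp g) : sameSlot L a b = sameSlot L b a := by
  have h : L (Th g (TensorAlgebra.ι ℚ a) 1 1 (TensorAlgebra.ι ℚ b)) =
      L (Th g (TensorAlgebra.ι ℚ b) 1 1 (TensorAlgebra.ι ℚ a)) := by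
    rw [← hL.innerSlots_eq b a]
    simpa [Th_neg₁, Th_neg₂, Th_neg₃, Th_neg₄] using
      (hL.sides (TensorAlgebra.ι ℚ a) 1 1 (TensorAlgebra.ι ℚ b)).symm
  rw [hL.outerSlots_eq, hL.outerSlots_eq, hL.sideSlots_symm a b, hL.crossSlots_symm a b] at h
  exact sub_right_injective h

lemma map_Th_span_eq_zero {L : T4 g →ₗ[ℚ] V} {A B C D : Set (TA g)}
    (h : ∀ t ∈ A, ∀ u ∈ B, ∀ v ∈ C, ∀ w ∈ D, L (Th g t u v w) = 0) {t u v w : TA g}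
    (ht : t ∈ Submodule.span ℚ A) (hu : u ∈ Submodule.span ℚ B) (hv : v ∈ Submodule.span ℚ C)
    (hw : w ∈ Submodule.span ℚ D) : L (Th g t u v w) = 0 := by
  induction ht using Submodule.span_induction with
  | zero => simp [Th]
  | add x y _ _ hx hy => rw [Th_add₁, map_add, hx, hy, add_zero]
  | smul c x _ hx => rw [Th_smul₁, map_smul, hx, smul_zero]
  | mem t ht =>
  induction hu using Submodule.span_induction with
  | zero => simp [Th]
  | add x y _ _ hx hy => rw [Th_add₂, map_add, hx, hy, add_zero]
  | smul c x _ hx => rw [Th_smul₂, map_smul, hx, smul_zero]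
  | mem u hu =>
  induction hv using Submodule.span_induction with
  | zero => simp [Th]
  | add x y _ _ hx hy => rw [Th_add₃, map_add, hx, hy, add_zero]
  | smul c x _ hx => rw [Th_smul₃, map_smul, hx, smul_zero]
  | mem v hv =>
  induction hw using Submodule.span_induction with
  | zero => simp [Th]
  | add x y _ _ hx hy => rw [Th_add₄, map_add, hx, hy, add_zero]
  | smul c x _ hx => rw [Th_smul₄, map_smul, hx, smul_zero]
  | mem w hw => exact h t ht u hu v hv w hw

open scoped Pointwise in
lemma TAdeg_eq_span (n : ℕ) :
    TAdeg g n = Submodule.span ℚ (Set.range (TensorAlgebra.ι ℚ : Hsp g →ₗ[ℚ] TA g) ^ n) := by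
  rw [← Submodule.span_pow, TAdeg]
  congr 1
  exact (Submodule.span_eq (LinearMap.range (TensorAlgebra.ι ℚ : Hsp g →ₗ[ℚ] TA g))).symm

open scoped Pointwise in
/-- A linear map vanishes in degree two as soon as it vanishes on words in the ten possible
distributions of two letters. -/
lemma map_eq_zero_of_mem_T4deg_two {L : T4 g →ₗ[ℚ] V}
    (h₂₀₀₀ : ∀ a b : Hsp g, L (Th g (TensorAlgebra.ι ℚ a * TensorAlgebra.ι ℚ b) 1 1 1) = 0)
    (h₀₂₀₀ : ∀ a b : Hsp g, L (Th g 1 (TensorAlgebra.ι ℚ a * TensorAlgebra.ι ℚ b) 1 1) = 0)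
    (h₀₀₂₀ : ∀ a b : Hsp g, L (Th g 1 1 (TensorAlgebra.ι ℚ a * TensorAlgebra.ι ℚ b) 1) = 0)
    (h₀₀₀₂ : ∀ a b : Hsp g, L (Th g 1 1 1 (TensorAlgebra.ι ℚ a * TensorAlgebra.ι ℚ b)) = 0)
    (h₁₁₀₀ : ∀ a b : Hsp g, L (Th g (TensorAlgebra.ι ℚ a) (TensorAlgebra.ι ℚ b) 1 1) = 0)
    (h₁₀₁₀ : ∀ a b : Hsp g, L (Th g (TensorAlgebra.ι ℚ a) 1 (TensorAlgebra.ι ℚ b) 1) = 0)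
    (h₁₀₀₁ : ∀ a b : Hsp g, L (Th g (TensorAlgebra.ι ℚ a) 1 1 (TensorAlgebra.ι ℚ b)) = 0)
    (h₀₁₁₀ : ∀ a b : Hsp g, L (Th g 1 (TensorAlgebra.ι ℚ a) (TensorAlgebra.ι ℚ b) 1) = 0)
    (h₀₁₀₁ : ∀ a b : Hsp g, L (Th g 1 (TensorAlgebra.ι ℚ a) 1 (TensorAlgebra.ι ℚ b)) = 0)
    (h₀₀₁₁ : ∀ a b : Hsp g, L (Th g 1 1 (TensorAlgebra.ι ℚ a) (TensorAlgebra.ι ℚ b)) = 0)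
    {x : T4 g} (hx : x ∈ T4deg g 2) : L x = 0 := by
  induction hx using Submodule.span_induction with
  | zero => exact map_zero L
  | add x y _ _ hx hy => rw [map_add, hx, hy, add_zero]
  | smul c x _ hx => rw [map_smul, hx, smul_zero]
  | mem x hx =>
    obtain ⟨i, j, k, l, hsum, t, ht, u, hu, v, hv, w, hw, rfl⟩ := hx
    rw [TAdeg_eq_span] at ht hu hv hw
    refine map_Th_span_eq_zero ?_ ht hu hv hw
    clear ht hu hv hw
    rcases i with _ | _ | _ | i <;> rcases j with _ | _ | _ | j <;>
      rcases k with _ | _ | _ | k <;> try omega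
    · obtain rfl : l = 2 := by omega
      simp only [pow_zero, pow_two]
      rintro _ rfl _ rfl _ rfl _ ⟨_, ⟨a, rfl⟩, _, ⟨b, rfl⟩, rfl⟩
      exact h₀₀₀₂ a b
    · obtain rfl : l = 1 := by omega
      simp only [zero_add, pow_zero, pow_one]
      rintro _ rfl _ rfl _ ⟨a, rfl⟩ _ ⟨b, rfl⟩
      exact h₀₀₁₁ a b
    · obtain rfl : l = 0 := by omega
      simp only [zero_add, Nat.reduceAdd, pow_zero, pow_two]
      rintro _ rfl _ rfl _ ⟨_, ⟨a, rfl⟩, _, ⟨b, rfl⟩, rfl⟩ _ rfl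
      exact h₀₀₂₀ a b
    · obtain rfl : l = 1 := by omega
      simp only [zero_add, pow_zero, pow_one]
      rintro _ rfl _ ⟨a, rfl⟩ _ rfl _ ⟨b, rfl⟩
      exact h₀₁₀₁ a b
    · obtain rfl : l = 0 := by omega
      simp only [zero_add, pow_zero, pow_one]
      rintro _ rfl _ ⟨a, rfl⟩ _ ⟨b, rfl⟩ _ rfl
      exact h₀₁₁₀ a b
    · obtain rfl : l = 0 := by omega
      simp only [zero_add, Nat.reduceAdd, pow_zero, pow_two]
      rintro _ rfl _ ⟨_, ⟨a, rfl⟩, _, ⟨b, rfl⟩, rfl⟩ _ rfl _ rfl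
      exact h₀₂₀₀ a b
    · obtain rfl : l = 1 := by omega
      simp only [zero_add, pow_zero, pow_one]
      rintro _ ⟨a, rfl⟩ _ rfl _ rfl _ ⟨b, rfl⟩
      exact h₁₀₀₁ a b
    · obtain rfl : l = 0 := by omega
      simp only [zero_add, pow_zero, pow_one]
      rintro _ ⟨a, rfl⟩ _ rfl _ ⟨b, rfl⟩ _ rfl
      exact h₁₀₁₀ a b
    · obtain rfl : l = 0 := by omega
      simp only [zero_add, pow_zero, pow_one]
      rintro _ ⟨a, rfl⟩ _ ⟨b, rfl⟩ _ rfl _ rfl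
      exact h₁₁₀₀ a b
    · obtain rfl : l = 0 := by omega
      simp only [zero_add, Nat.reduceAdd, pow_zero, pow_two]
      rintro _ ⟨_, ⟨a, rfl⟩, _, ⟨b, rfl⟩, rfl⟩ _ rfl _ rfl _ rfl
      exact h₂₀₀₀ a b

/-- A theta-invariant map vanishes in degree two as soon as it vanishes on the three families
`Θ(ab,1,1,1)`, `Θ(a,b,1,1)` and `Θ(a,1,b,1)`. -/
lemma IsThetaInvariant.eq_zero_of_mem_T4deg {L : T4 g →ₗ[ℚ] V} (hL : IsThetaInvariant L)
    (hsame : ∀ a b, sameSlot L a b = 0) (hside : ∀ a b, sideSlots L a b = 0)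
    (hcross : ∀ a b, crossSlots L a b = 0) {x : T4 g} (hx : x ∈ T4deg g 2) : L x = 0 := by
  have houter (a b : Hsp g) : L (Th g (TensorAlgebra.ι ℚ a) 1 1 (TensorAlgebra.ι ℚ b)) = 0 := by
    rw [hL.outerSlots_eq, hsame, hside, hcross, add_zero, sub_zero]
  have hinner (a b : Hsp g) : L (Th g 1 (TensorAlgebra.ι ℚ a) (TensorAlgebra.ι ℚ b) 1) = 0 := by
    rw [hL.innerSlots_eq, houter]
  have hside' (a b : Hsp g) : L (Th g 1 1 (TensorAlgebra.ι ℚ a) (TensorAlgebra.ι ℚ b)) = 0 := by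
    have h := hL.slots (TensorAlgebra.ι ℚ a) (TensorAlgebra.ι ℚ b) 1 1
    rw [← sideSlots_apply, hside] at h
    simpa [Th_neg₃, Th_neg₄] using h
  have hcross' (a b : Hsp g) : L (Th g 1 (TensorAlgebra.ι ℚ a) 1 (TensorAlgebra.ι ℚ b)) = 0 := by
    have h := hL.sides (TensorAlgebra.ι ℚ a) 1 (TensorAlgebra.ι ℚ b) 1
    rw [← crossSlots_apply, hcross] at h
    simpa [Th_neg₂, Th_neg₄] using h
  have hsame₂ (a b : Hsp g) : L (Th g 1 (TensorAlgebra.ι ℚ a * TensorAlgebra.ι ℚ b) 1 1) = 0 := by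
    have h := hL.sides (TensorAlgebra.ι ℚ b * TensorAlgebra.ι ℚ a) 1 1 1
    rw [← sameSlot_apply, hsame] at h
    simpa using h
  have hsame₃ (a b : Hsp g) : L (Th g 1 1 (TensorAlgebra.ι ℚ a * TensorAlgebra.ι ℚ b) 1) = 0 := by
    have h := hL.slots (TensorAlgebra.ι ℚ b * TensorAlgebra.ι ℚ a) 1 1 1
    rw [← sameSlot_apply, hsame] at h
    simpa using h
  have hsame₄ (a b : Hsp g) : L (Th g 1 1 1 (TensorAlgebra.ι ℚ a * TensorAlgebra.ι ℚ b)) = 0 := by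
    have h := hL.slots 1 (TensorAlgebra.ι ℚ b * TensorAlgebra.ι ℚ a) 1 1
    rw [hsame₂] at h
    simpa using h
  exact map_eq_zero_of_mem_T4deg_two hsame hsame₂ hsame₃ hsame₄ hside hcross houter hinner hcross'
    hside' hx

lemma barT_mem_TAdeg {n : ℕ} {t : TA g} (ht : t ∈ TAdeg g n) : barT g t ∈ TAdeg g n := by
  induction n generalizing t with
  | zero =>
    obtain ⟨c, rfl⟩ := Submodule.mem_one.mp ht
    rwa [barT_algebraMap]
  | succ n ih =>
    rw [TAdeg, pow_succ] at ht
    induction ht using Submodule.mul_induction_on' with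
    | mem_mul_mem x hx y hy =>
      obtain ⟨a, rfl⟩ := hy
      rw [barT_mul, barT_ι, TAdeg, pow_succ']
      exact Submodule.mul_mem_mul (Submodule.neg_mem _ ⟨a, rfl⟩) (ih hx)
    | add x _ y _ hx hy => rw [map_add]; exact Submodule.add_mem _ hx hy

lemma barT_barT (t : TA g) : barT g (barT g t) = t := by
  induction t using TensorAlgebra.induction with
  | algebraMap r => simp
  | ι a => simp
  | mul x y hx hy => simp [hx, hy]
  | add x y hx hy => simp [hx, hy]

lemma IsThetaInvariant.sub {L K : T4 g →ₗ[ℚ] V} (hL : IsThetaInvariant L)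
    (hK : IsThetaInvariant K) : IsThetaInvariant (L - K) :=
  (hL.prod hK).comp (LinearMap.fst ℚ V V - LinearMap.snd ℚ V V)

/-- A theta-invariant map, extended to dumbbell generators by (CC), respects all relations of
`C₁₂`. -/
lemma IsThetaInvariant.coprod_eq_zero {Q R : T4 g →ₗ[ℚ] V} (hQ : IsThetaInvariant Q)
    (hR : ∀ t u v w, R (Th g t u v w) = Q (Th g t u v w) + Q (Th g (barT g v) u (barT g t) w)) :
    Submodule.span ℚ (C12Rel g) ≤ LinearMap.ker (Q.coprod R) := by
  rw [Submodule.span_le]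
  rintro x (⟨t, u, v, w, rfl⟩ | ⟨t, u, v, w, rfl⟩ | ⟨t, u, v, w, rfl⟩ | ⟨t, u, v, w, rfl⟩ |
    ⟨t, u, v, w, a, rfl⟩ | ⟨t, u, v, w, a, rfl⟩ | ⟨t, u, v, w, rfl⟩) <;>
  simp only [SetLike.mem_coe, LinearMap.mem_ker, ThP, DP, map_sub, map_add,
    LinearMap.coprod_apply, map_zero, add_zero, zero_add, hR]
  · rw [hQ.slots, sub_self]
  · rw [hQ.sides, sub_self]
  · rw [barT_barT, barT_barT]
    abel
  · have h := hQ.slots (barT g v) u (barT g t) w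
    have h' := hQ.sides w (barT g t) u (barT g v)
    simp only [barT_barT] at h h' ⊢
    rw [hQ.sides, ← h, ← h', sub_self]
  · exact hQ.hair t u v w a
  · have h := hQ.hair t u v w a
    have h' := hQ.hair (barT g v) u (barT g t) w a
    simp only [barT_mul, barT_ι, mul_neg, neg_mul, Th_neg₁, Th_neg₃, map_neg]
    have e := congrArg₂ (fun x y => -x - y) h h'
    simp only [neg_zero, sub_zero] at e
    refine Eq.trans ?_ e
    abel
  · abel

end ThetaInvariance

section Coordinates

variable {g : ℕ}

/-- `quadEval` with values in `Sym²H`. -/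
def symQuad (g : ℕ) (a b c d : ℚ) : T4 g →ₗ[ℚ] SymP g 2 :=
  (quadEval g a b c d).codRestrict _ (quadEval_mem a b c d)

lemma coe_symQuad (a b c d : ℚ) (x : T4 g) :
    (symQuad g a b c d x : MvPolynomial (Fin (2 * g)) ℚ) = quadEval g a b c d x := rfl

lemma quadEval_sameSlot (a b c d : ℚ) (x y : Hsp g) :
    quadEval g a b c d (Th g (TensorAlgebra.ι ℚ x * TensorAlgebra.ι ℚ y) 1 1 1) =
      (a * a) • (linForm g x * linForm g y) := by
  simp [quadEval_apply, fourEval_Th, Polynomial.monomial_mul_monomial, smul_smul]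

lemma quadEval_sideSlots (a b c d : ℚ) (x y : Hsp g) :
    quadEval g a b c d (Th g (TensorAlgebra.ι ℚ x) (TensorAlgebra.ι ℚ y) 1 1) =
      (a * b) • (linForm g x * linForm g y) := by
  simp [quadEval_apply, fourEval_Th, Polynomial.monomial_mul_monomial, smul_smul, mul_comm]

lemma quadEval_crossSlots (a b c d : ℚ) (x y : Hsp g) :
    quadEval g a b c d (Th g (TensorAlgebra.ι ℚ x) 1 (TensorAlgebra.ι ℚ y) 1) =
      (a * c) • (linForm g x * linForm g y) := by
  simp [quadEval_apply, fourEval_Th, Polynomial.monomial_mul_monomial, smul_smul, mul_comm]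

/-- `quadEval` is theta-invariant when its weights satisfy the hair relation and are permuted by
the symmetries up to sign. -/
lemma isThetaInvariant_symQuad {a b c d : ℚ} (h : a + d = b + c)
    (hslots : ∀ t u v w, quadEval g c d a b (Th g t u v w) = quadEval g a b c d (Th g t u v w))
    (hsides : ∀ t u v w, quadEval g b a d c (Th g t u v w) = quadEval g a b c d (Th g t u v w)) :
    IsThetaInvariant (symQuad g a b c d) where
  slots t u v w := Subtype.ext ((quadEval_barT_slots a b c d t u v w).trans (hslots t u v w))
  sides t u v w := Subtype.ext ((quadEval_barT_sides a b c d t u v w).trans (hsides t u v w))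
  hair t u v w x := Subtype.ext (quadEval_hair h t u v w x)

lemma isThetaInvariant_symQuad_constant : IsThetaInvariant (symQuad g 1 1 1 1) :=
  isThetaInvariant_symQuad rfl (fun _ _ _ _ => rfl) fun _ _ _ _ => rfl

lemma isThetaInvariant_symQuad_sides : IsThetaInvariant (symQuad g 1 1 (-1) (-1)) :=
  isThetaInvariant_symQuad (by norm_num)
    (fun t u v w => by simpa using quadEval_neg 1 1 (-1) (-1) t u v w) fun _ _ _ _ => rfl

lemma isThetaInvariant_symQuad_cross : IsThetaInvariant (symQuad g 1 (-1) 1 (-1)) :=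
  isThetaInvariant_symQuad (by norm_num) (fun _ _ _ _ => rfl)
    fun t u v w => by simpa using quadEval_neg 1 (-1) 1 (-1) t u v w

variable {V W : Type*} [AddCommGroup V] [Module ℚ V] [AddCommGroup W] [Module ℚ W]

lemma polySection_smul_mul {B : Hsp g →ₗ[ℚ] Hsp g →ₗ[ℚ] V} (hB : ∀ a b, B a b = B b a) (c : ℚ)
    (a b : Hsp g) : polySection B (c • (linForm g a * linForm g b)) = c • B a b := by
  rw [map_smul, polySection_mul B hB]

lemma map_polySection_eq_smul {B : Hsp g →ₗ[ℚ] Hsp g →ₗ[ℚ] V}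
    {L : V →ₗ[ℚ] MvPolynomial (Fin (2 * g)) ℚ} {c : ℚ}
    (h : ∀ a b, L (B a b) = c • (linForm g a * linForm g b)) (p : SymP g 2) :
    L (polySection B p) = c • (p : MvPolynomial (Fin (2 * g)) ℚ) := by
  have hB : B.compr₂ L = (linFormMul g).compr₂ (c • LinearMap.id) := by
    refine LinearMap.ext fun a => LinearMap.ext fun b => ?_
    exact h a b
  rw [map_polySection, hB, ← map_polySection, polySection_linFormMul p.2]
  rfl

/-- A linear map with a section valued in a submodule `N`, which is also a left inverse on `N`,
restricts to an equivalence on `N`. -/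
def equivOfSection (N : Submodule ℚ V) (f : V →ₗ[ℚ] W) (s : W →ₗ[ℚ] V) (hs : ∀ p, s p ∈ N)
    (hfs : ∀ p, f (s p) = p) (hsf : ∀ x ∈ N, s (f x) = x) : N ≃ₗ[ℚ] W :=
  LinearEquiv.ofLinearMap (f.domRestrict N) (s.codRestrict N hs)
    (LinearMap.ext hfs) (LinearMap.ext fun x => Subtype.ext (hsf x x.2))

lemma equivOfSection_apply (N : Submodule ℚ V) (f : V →ₗ[ℚ] W) (s : W →ₗ[ℚ] V) (hs : ∀ p, s p ∈ N)
    (hfs : ∀ p, f (s p) = p) (hsf : ∀ x ∈ N, s (f x) = x) (x : N) :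
    equivOfSection N f s hs hfs hsf x = f x := rfl

lemma ι_mem_TAdeg (a : Hsp g) : TensorAlgebra.ι ℚ a ∈ TAdeg g 1 := by
  rw [TAdeg, pow_one]
  exact ⟨a, rfl⟩

lemma ι_mul_ι_mem_TAdeg (a b : Hsp g) :
    TensorAlgebra.ι ℚ a * TensorAlgebra.ι ℚ b ∈ TAdeg g 2 := by
  rw [TAdeg, pow_two]
  exact Submodule.mul_mem_mul ⟨a, rfl⟩ ⟨b, rfl⟩

lemma one_mem_TAdeg : (1 : TA g) ∈ TAdeg g 0 := by
  rw [TAdeg, pow_zero]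
  exact Submodule.one_le.mp le_rfl

lemma sameSlot_mem_T4deg (a b : Hsp g) :
    Th g (TensorAlgebra.ι ℚ a * TensorAlgebra.ι ℚ b) 1 1 1 ∈ T4deg g 2 :=
  Submodule.subset_span ⟨2, 0, 0, 0, rfl, _, ι_mul_ι_mem_TAdeg a b, _, one_mem_TAdeg, _,
    one_mem_TAdeg, _, one_mem_TAdeg, rfl⟩

lemma sideSlots_mem_T4deg (a b : Hsp g) :
    Th g (TensorAlgebra.ι ℚ a) (TensorAlgebra.ι ℚ b) 1 1 ∈ T4deg g 2 :=
  Submodule.subset_span ⟨1, 1, 0, 0, rfl, _, ι_mem_TAdeg a, _, ι_mem_TAdeg b, _,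
    one_mem_TAdeg, _, one_mem_TAdeg, rfl⟩

lemma crossSlots_mem_T4deg (a b : Hsp g) :
    Th g (TensorAlgebra.ι ℚ a) 1 (TensorAlgebra.ι ℚ b) 1 ∈ T4deg g 2 :=
  Submodule.subset_span ⟨1, 0, 1, 0, rfl, _, ι_mem_TAdeg a, _, one_mem_TAdeg, _,
    ι_mem_TAdeg b, _, one_mem_TAdeg, rfl⟩

end Coordinates

section Dumbbell

variable {g : ℕ}

/-- The three coordinates of theta generators of `C₁₂`. -/
def thetaCoord (g : ℕ) : T4 g →ₗ[ℚ] SymP g 2 × SymP g 2 × SymP g 2 :=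
  (symQuad g 1 1 1 1).prod ((symQuad g 1 1 (-1) (-1)).prod (symQuad g 1 (-1) 1 (-1)))

/-- The three coordinates of dumbbell generators of `C₁₂`. -/
def dumbbellCoord (g : ℕ) : T4 g →ₗ[ℚ] SymP g 2 × SymP g 2 × SymP g 2 :=
  (symQuad g 1 1 1 1 + symQuad g 1 (-1) 1 (-1)).prod
    (((2 : ℚ) • symQuad g 1 1 (-1) (-1)).prod (symQuad g 1 1 1 1 + symQuad g 1 (-1) 1 (-1)))

lemma isThetaInvariant_thetaCoord : IsThetaInvariant (thetaCoord g) :=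
  isThetaInvariant_symQuad_constant.prod
    (isThetaInvariant_symQuad_sides.prod isThetaInvariant_symQuad_cross)

lemma dumbbellCoord_Th (t u v w : TA g) :
    dumbbellCoord g (Th g t u v w) =
      thetaCoord g (Th g t u v w) + thetaCoord g (Th g (barT g v) u (barT g t) w) := by
  refine Prod.ext (Subtype.ext ?_) (Prod.ext (Subtype.ext ?_) (Subtype.ext ?_))
  · change quadEval g 1 1 1 1 _ + quadEval g 1 (-1) 1 (-1) _ =
      quadEval g 1 1 1 1 _ + quadEval g 1 1 1 1 _
    rw [quadEval_barT_exchange, ← quadEval_neg (-1) 1 (-1) 1, neg_neg]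
  · change (2 : ℚ) • quadEval g 1 1 (-1) (-1) _ =
      quadEval g 1 1 (-1) (-1) _ + quadEval g 1 1 (-1) (-1) _
    rw [quadEval_barT_exchange, neg_neg, two_smul]
  · change quadEval g 1 1 1 1 _ + quadEval g 1 (-1) 1 (-1) _ =
      quadEval g 1 (-1) 1 (-1) _ + quadEval g 1 (-1) 1 (-1) _
    rw [quadEval_barT_exchange, quadEval_neg, add_comm]

/-- The three coordinates on `C₁₂`. -/
def c12Coord (g : ℕ) : C12 g →ₗ[ℚ] SymP g 2 × SymP g 2 × SymP g 2 :=
  (Submodule.span ℚ (C12Rel g)).liftQ ((thetaCoord g).coprod (dumbbellCoord g))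
    (isThetaInvariant_thetaCoord.coprod_eq_zero dumbbellCoord_Th)

lemma c12Coord_mk (p : P2 g) :
    c12Coord g (Submodule.Quotient.mk p) = thetaCoord g p.1 + dumbbellCoord g p.2 := rfl

/-- The class in `C₁₂` of an element spanned by theta generators. -/
def thetaClass (g : ℕ) : T4 g →ₗ[ℚ] C12 g :=
  (Submodule.span ℚ (C12Rel g)).mkQ ∘ₗ LinearMap.inl ℚ (T4 g) (T4 g)

lemma c12Coord_thetaClass (x : T4 g) : c12Coord g (thetaClass g x) = thetaCoord g x := by
  change thetaCoord g x + dumbbellCoord g 0 = _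
  rw [map_zero, add_zero]

lemma C12_mk_eq_zero {x : P2 g} (hx : x ∈ C12Rel g) :
    (Submodule.span ℚ (C12Rel g)).mkQ x = 0 :=
  (Submodule.Quotient.mk_eq_zero _).mpr (Submodule.subset_span hx)

lemma isThetaInvariant_thetaClass : IsThetaInvariant (thetaClass g) where
  slots t u v w := by
    have h := C12_mk_eq_zero (g := g) (Or.inl ⟨t, u, v, w, rfl⟩)
    rw [map_sub, sub_eq_zero] at h
    exact h.symm
  sides t u v w := by
    have h := C12_mk_eq_zero (g := g) (Or.inr (Or.inl ⟨t, u, v, w, rfl⟩))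
    rw [map_sub, sub_eq_zero] at h
    exact h.symm
  hair t u v w a := by
    have h := C12_mk_eq_zero (g := g)
      (Or.inr (Or.inr (Or.inr (Or.inr (Or.inl ⟨t, u, v, w, a, rfl⟩)))))
    rw [map_add, map_sub, map_sub] at h
    exact h

lemma mk_DP_eq (t u v w : TA g) :
    (Submodule.span ℚ (C12Rel g)).mkQ (DP g t u v w) =
      thetaClass g (Th g t u v w) + thetaClass g (Th g (barT g v) u (barT g t) w) := by
  have h := C12_mk_eq_zero (g := g)
    (Or.inr (Or.inr (Or.inr (Or.inr (Or.inr (Or.inr ⟨t, u, v, w, rfl⟩))))))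
  rw [map_sub, map_sub, sub_sub, sub_eq_zero] at h
  exact h

/-- The bilinear map dual to the first coordinate on `C₁₂`. -/
def constantPairing (g : ℕ) : Hsp g →ₗ[ℚ] Hsp g →ₗ[ℚ] C12 g :=
  (1 / 2 : ℚ) • (sideSlots (thetaClass g) + crossSlots (thetaClass g))

/-- The bilinear map dual to the second coordinate on `C₁₂`. -/
def sidesPairing (g : ℕ) : Hsp g →ₗ[ℚ] Hsp g →ₗ[ℚ] C12 g :=
  (1 / 2 : ℚ) • (sameSlot (thetaClass g) - crossSlots (thetaClass g))

/-- The bilinear map dual to the third coordinate on `C₁₂`. -/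
def crossPairing (g : ℕ) : Hsp g →ₗ[ℚ] Hsp g →ₗ[ℚ] C12 g :=
  (1 / 2 : ℚ) • (sameSlot (thetaClass g) - sideSlots (thetaClass g))

lemma constantPairing_apply (a b : Hsp g) : constantPairing g a b =
    (1 / 2 : ℚ) • (sideSlots (thetaClass g) a b + crossSlots (thetaClass g) a b) := rfl

lemma sidesPairing_apply (a b : Hsp g) : sidesPairing g a b =
    (1 / 2 : ℚ) • (sameSlot (thetaClass g) a b - crossSlots (thetaClass g) a b) := rfl

lemma crossPairing_apply (a b : Hsp g) : crossPairing g a b =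
    (1 / 2 : ℚ) • (sameSlot (thetaClass g) a b - sideSlots (thetaClass g) a b) := rfl

lemma constantPairing_symm (a b : Hsp g) : constantPairing g a b = constantPairing g b a := by
  rw [constantPairing_apply, isThetaInvariant_thetaClass.sideSlots_symm,
    isThetaInvariant_thetaClass.crossSlots_symm, ← constantPairing_apply]

lemma sidesPairing_symm (a b : Hsp g) : sidesPairing g a b = sidesPairing g b a := by
  rw [sidesPairing_apply, isThetaInvariant_thetaClass.sameSlot_symm,
    isThetaInvariant_thetaClass.crossSlots_symm, ← sidesPairing_apply]

lemma crossPairing_symm (a b : Hsp g) : crossPairing g a b = crossPairing g b a := by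
  rw [crossPairing_apply, isThetaInvariant_thetaClass.sameSlot_symm,
    isThetaInvariant_thetaClass.sideSlots_symm, ← crossPairing_apply]

/-- The inverse of `c12Coord` in degree two. -/
def c12Section (g : ℕ) : SymP g 2 × SymP g 2 × SymP g 2 →ₗ[ℚ] C12 g :=
  (polySection (constantPairing g) ∘ₗ Submodule.subtype _).coprod
    ((polySection (sidesPairing g) ∘ₗ Submodule.subtype _).coprod
      (polySection (crossPairing g) ∘ₗ Submodule.subtype _))

lemma c12Section_apply (p : SymP g 2 × SymP g 2 × SymP g 2) :
    c12Section g p = polySection (constantPairing g) p.1 +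
      (polySection (sidesPairing g) p.2.1 + polySection (crossPairing g) p.2.2) := rfl

lemma thetaClass_mem_C12deg {x : T4 g} (hx : x ∈ T4deg g 2) : thetaClass g x ∈ C12deg g 2 :=
  Submodule.mem_map_of_mem (f := (Submodule.span ℚ (C12Rel g)).mkQ)
    (p := (T4deg g 2).prod (T4deg g 2)) ⟨hx, Submodule.zero_mem _⟩

lemma c12Section_mem (p : SymP g 2 × SymP g 2 × SymP g 2) : c12Section g p ∈ C12deg g 2 := by
  have hsame (a b : Hsp g) : sameSlot (thetaClass g) a b ∈ C12deg g 2 :=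
    thetaClass_mem_C12deg (sameSlot_mem_T4deg a b)
  have hside (a b : Hsp g) : sideSlots (thetaClass g) a b ∈ C12deg g 2 :=
    thetaClass_mem_C12deg (sideSlots_mem_T4deg a b)
  have hcross (a b : Hsp g) : crossSlots (thetaClass g) a b ∈ C12deg g 2 :=
    thetaClass_mem_C12deg (crossSlots_mem_T4deg a b)
  rw [c12Section_apply]
  exact Submodule.add_mem _
    (polySection_mem _ _ (fun a b => Submodule.smul_mem _ _
      (Submodule.add_mem _ (hside a b) (hcross a b))) _)
    (Submodule.add_mem _
      (polySection_mem _ _ (fun a b => Submodule.smul_mem _ _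
        (Submodule.sub_mem _ (hsame a b) (hcross a b))) _)
      (polySection_mem _ _ (fun a b => Submodule.smul_mem _ _
        (Submodule.sub_mem _ (hsame a b) (hside a b))) _))

lemma c12Coord_c12Section (p : SymP g 2 × SymP g 2 × SymP g 2) :
    c12Coord g (c12Section g p) = p := by
  have hval {L : C12 g →ₗ[ℚ] MvPolynomial (Fin (2 * g)) ℚ} {x y z : ℚ}
      (hsame : ∀ a b, L (sameSlot (thetaClass g) a b) = x • (linForm g a * linForm g b))
      (hside : ∀ a b, L (sideSlots (thetaClass g) a b) = y • (linForm g a * linForm g b))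
      (hcross : ∀ a b, L (crossSlots (thetaClass g) a b) = z • (linForm g a * linForm g b)) :
      L (c12Section g p) = ((1 / 2 : ℚ) * (y + z)) • (p.1 : MvPolynomial (Fin (2 * g)) ℚ) +
        (((1 / 2 : ℚ) * (x - z)) • (p.2.1 : MvPolynomial (Fin (2 * g)) ℚ) +
          ((1 / 2 : ℚ) * (x - y)) • (p.2.2 : MvPolynomial (Fin (2 * g)) ℚ)) := by
    rw [c12Section_apply, map_add, map_add]
    congr 2
    · refine map_polySection_eq_smul (fun a b => ?_) _
      rw [constantPairing_apply, map_smul, map_add, hside, hcross, ← add_smul, smul_smul]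
    · refine map_polySection_eq_smul (fun a b => ?_) _
      rw [sidesPairing_apply, map_smul, map_sub, hsame, hcross, ← sub_smul, smul_smul]
    · refine map_polySection_eq_smul (fun a b => ?_) _
      rw [crossPairing_apply, map_smul, map_sub, hsame, hside, ← sub_smul, smul_smul]
  have hcoord {q : SymP g 2 × SymP g 2 × SymP g 2 →ₗ[ℚ] SymP g 2} {s₁ s₂ s₃ s₄ : ℚ}
      (hq : q ∘ₗ thetaCoord g = symQuad g s₁ s₂ s₃ s₄) (x : T4 g) :
      (Submodule.subtype _ ∘ₗ q ∘ₗ c12Coord g) (thetaClass g x) = quadEval g s₁ s₂ s₃ s₄ x := by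
    change ((q (c12Coord g (thetaClass g x)) : SymP g 2) : MvPolynomial (Fin (2 * g)) ℚ) = _
    rw [c12Coord_thetaClass, ← coe_symQuad, ← hq]
    rfl
  refine Prod.ext (Subtype.ext ?_) (Prod.ext (Subtype.ext ?_) (Subtype.ext ?_))
  · have h := hcoord (q := LinearMap.fst _ _ _) (s₁ := 1) (s₂ := 1) (s₃ := 1) (s₄ := 1) rfl
    refine (hval (fun a b => (h _).trans (quadEval_sameSlot _ _ _ _ a b))
      (fun a b => (h _).trans (quadEval_sideSlots _ _ _ _ a b))
      (fun a b => (h _).trans (quadEval_crossSlots _ _ _ _ a b))).trans ?_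
    norm_num
  · have h := hcoord (q := LinearMap.fst _ _ _ ∘ₗ LinearMap.snd _ _ _)
      (s₁ := 1) (s₂ := 1) (s₃ := -1) (s₄ := -1) rfl
    refine (hval (fun a b => (h _).trans (quadEval_sameSlot _ _ _ _ a b))
      (fun a b => (h _).trans (quadEval_sideSlots _ _ _ _ a b))
      (fun a b => (h _).trans (quadEval_crossSlots _ _ _ _ a b))).trans ?_
    norm_num
  · have h := hcoord (q := LinearMap.snd _ _ _ ∘ₗ LinearMap.snd _ _ _)
      (s₁ := 1) (s₂ := -1) (s₃ := 1) (s₄ := -1) rfl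
    refine (hval (fun a b => (h _).trans (quadEval_sameSlot _ _ _ _ a b))
      (fun a b => (h _).trans (quadEval_sideSlots _ _ _ _ a b))
      (fun a b => (h _).trans (quadEval_crossSlots _ _ _ _ a b))).trans ?_
    norm_num

lemma c12Section_thetaCoord {x : T4 g} {s₁ s₂ s₃ : ℚ} {a b : Hsp g}
    (h₁ : quadEval g 1 1 1 1 x = s₁ • (linForm g a * linForm g b))
    (h₂ : quadEval g 1 1 (-1) (-1) x = s₂ • (linForm g a * linForm g b))
    (h₃ : quadEval g 1 (-1) 1 (-1) x = s₃ • (linForm g a * linForm g b)) :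
    c12Section g (thetaCoord g x) = s₁ • constantPairing g a b +
      (s₂ • sidesPairing g a b + s₃ • crossPairing g a b) := by
  change polySection (constantPairing g) (quadEval g 1 1 1 1 x) +
    (polySection (sidesPairing g) (quadEval g 1 1 (-1) (-1) x) +
      polySection (crossPairing g) (quadEval g 1 (-1) 1 (-1) x)) = _
  simp only [h₁, h₂, h₃, polySection_smul_mul constantPairing_symm,
    polySection_smul_mul sidesPairing_symm, polySection_smul_mul crossPairing_symm]

lemma c12Section_c12Coord {x : C12 g} (hx : x ∈ C12deg g 2) :
    c12Section g (c12Coord g x) = x := by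
  set F : C12 g →ₗ[ℚ] C12 g := LinearMap.id - c12Section g ∘ₗ c12Coord g
  have hFθ (x : T4 g) : F (thetaClass g x) = thetaClass g x - c12Section g (thetaCoord g x) := by
    rw [← c12Coord_thetaClass]
    rfl
  have hθ {x : T4 g} (hx : x ∈ T4deg g 2) : (F ∘ₗ thetaClass g) x = 0 := by
    refine (isThetaInvariant_thetaClass.comp F).eq_zero_of_mem_T4deg ?_ ?_ ?_ hx
    · intro a b
      refine (hFθ _).trans ?_
      rw [c12Section_thetaCoord
        (quadEval_sameSlot _ _ _ _ a b) (quadEval_sameSlot _ _ _ _ a b)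
        (quadEval_sameSlot _ _ _ _ a b)]
      simp only [constantPairing_apply, sidesPairing_apply, crossPairing_apply]
      change sameSlot (thetaClass g) a b - _ = 0
      module
    · intro a b
      refine (hFθ _).trans ?_
      rw [c12Section_thetaCoord
        (quadEval_sideSlots _ _ _ _ a b) (quadEval_sideSlots _ _ _ _ a b)
        (quadEval_sideSlots _ _ _ _ a b)]
      simp only [constantPairing_apply, sidesPairing_apply, crossPairing_apply]
      change sideSlots (thetaClass g) a b - _ = 0
      module
    · intro a b
      refine (hFθ _).trans ?_
      rw [c12Section_thetaCoord
        (quadEval_crossSlots _ _ _ _ a b) (quadEval_crossSlots _ _ _ _ a b)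
        (quadEval_crossSlots _ _ _ _ a b)]
      simp only [constantPairing_apply, sidesPairing_apply, crossPairing_apply]
      change crossSlots (thetaClass g) a b - _ = 0
      module
  have hD {x : T4 g} (hx : x ∈ T4deg g 2) :
      (F ∘ₗ (Submodule.span ℚ (C12Rel g)).mkQ ∘ₗ LinearMap.inr ℚ (T4 g) (T4 g)) x = 0 := by
    induction hx using Submodule.span_induction with
    | zero => exact map_zero _
    | add x y _ _ hx hy => rw [map_add, hx, hy, add_zero]
    | smul c x _ hx => rw [map_smul, hx, smul_zero]
    | mem x hx =>
      obtain ⟨i, j, k, l, hsum, t, ht, u, hu, v, hv, w, hw, rfl⟩ := hx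
      refine (congrArg F (mk_DP_eq t u v w)).trans ?_
      rw [map_add]
      refine (congrArg₂ (· + ·) (hθ (Submodule.subset_span ⟨i, j, k, l, hsum, t, ht, u, hu,
        v, hv, w, hw, rfl⟩)) (hθ (Submodule.subset_span ⟨k, j, i, l, by omega, _,
          barT_mem_TAdeg hv, u, hu, _, barT_mem_TAdeg ht, w, hw, rfl⟩))).trans (add_zero 0)
  obtain ⟨p, hp, rfl⟩ := hx
  have h : F ((Submodule.span ℚ (C12Rel g)).mkQ p) = 0 := by
    have hp' : p = LinearMap.inl ℚ (T4 g) (T4 g) p.1 + LinearMap.inr ℚ (T4 g) (T4 g) p.2 := by simp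
    rw [hp', map_add, map_add]
    exact (congrArg₂ (· + ·) (hθ hp.1) (hD hp.2)).trans (add_zero 0)
  exact (sub_eq_zero.mp h).symm

/-- The equivalence `C₁₂^{(2)} ≅ (Sym²H)^{⊕3}`. -/
def c12Equiv (g : ℕ) : C12deg g 2 ≃ₗ[ℚ] SymP g 2 × SymP g 2 × SymP g 2 :=
  equivOfSection (C12deg g 2) (c12Coord g) (c12Section g) c12Section_mem c12Coord_c12Section
    fun _ => c12Section_c12Coord

end Dumbbell

section Omega

variable {g : ℕ}

/-- The coordinate of theta generators of `Ω̃₂`. -/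
def omegaFunctional (g : ℕ) : T4 g →ₗ[ℚ] SymP g 2 :=
  (3 : ℚ) • symQuad g 1 1 1 1 - symQuad g 1 (-1) 1 (-1)

lemma coe_omegaFunctional (x : T4 g) :
    (omegaFunctional g x : MvPolynomial (Fin (2 * g)) ℚ) =
      (3 : ℚ) • quadEval g 1 1 1 1 x - quadEval g 1 (-1) 1 (-1) x := rfl

lemma isThetaInvariant_omegaFunctional : IsThetaInvariant (omegaFunctional g) := by
  have h := (isThetaInvariant_symQuad_constant (g := g)).comp ((3 : ℚ) • LinearMap.id)
  rw [LinearMap.smul_comp, LinearMap.id_comp] at h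
  exact h.sub isThetaInvariant_symQuad_cross

lemma omegaFunctional_gc3 (t u v w : TA g) : omegaFunctional g (gc3 g t u v w) = 0 := by
  refine Subtype.ext ?_
  rw [coe_omegaFunctional, quadEval_gc3, quadEval_gc3]
  simp only [quadEval_Th, MvPolynomial.smul_eq_C_mul]
  norm_num [map_ofNat (MvPolynomial.C (R := ℚ) (σ := Fin (2 * g)))]
  ring

lemma OmegaRel_le_ker : Submodule.span ℚ (OmegaRel g) ≤ LinearMap.ker (omegaFunctional g) := by
  rw [Submodule.span_le]
  rintro x (⟨t, u, v, w, rfl⟩ | ⟨t, u, v, w, rfl⟩ | ⟨t, u, v, w, a, rfl⟩ | ⟨t, u, v, w, rfl⟩) <;>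
  simp only [SetLike.mem_coe, LinearMap.mem_ker, map_sub, map_add]
  · rw [isThetaInvariant_omegaFunctional.slots, sub_self]
  · rw [isThetaInvariant_omegaFunctional.sides, sub_self]
  · exact isThetaInvariant_omegaFunctional.hair t u v w a
  · exact omegaFunctional_gc3 t u v w

/-- The coordinate on `Ω̃₂`. -/
def omegaCoord (g : ℕ) : Omega2 g →ₗ[ℚ] SymP g 2 :=
  (Submodule.span ℚ (OmegaRel g)).liftQ (omegaFunctional g) OmegaRel_le_ker

lemma omegaCoord_mk (x : T4 g) :
    omegaCoord g (Submodule.Quotient.mk x) = omegaFunctional g x := rfl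

lemma Omega_mk_eq_zero {x : T4 g} (hx : x ∈ OmegaRel g) :
    (Submodule.span ℚ (OmegaRel g)).mkQ x = 0 :=
  (Submodule.Quotient.mk_eq_zero _).mpr (Submodule.subset_span hx)

lemma isThetaInvariant_omegaClass :
    IsThetaInvariant (Submodule.span ℚ (OmegaRel g)).mkQ where
  slots t u v w := by
    have h := Omega_mk_eq_zero (g := g) (Or.inl ⟨t, u, v, w, rfl⟩)
    rw [map_sub, sub_eq_zero] at h
    exact h.symm
  sides t u v w := by
    have h := Omega_mk_eq_zero (g := g) (Or.inr (Or.inl ⟨t, u, v, w, rfl⟩))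
    rw [map_sub, sub_eq_zero] at h
    exact h.symm
  hair t u v w a := by
    have h := Omega_mk_eq_zero (g := g) (Or.inr (Or.inr (Or.inl ⟨t, u, v, w, a, rfl⟩)))
    rw [map_add, map_sub, map_sub] at h
    exact h

lemma gc3_sideSlots (a b : Hsp g) :
    gc3 g (TensorAlgebra.ι ℚ a) (TensorAlgebra.ι ℚ b) 1 1 =
      Th g 1 (TensorAlgebra.ι ℚ a * TensorAlgebra.ι ℚ b) 1 1
        + Th g (TensorAlgebra.ι ℚ a * TensorAlgebra.ι ℚ b) 1 1 1
        - Th g (TensorAlgebra.ι ℚ a) (TensorAlgebra.ι ℚ b) 1 1 := by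
  simp only [gc3, gc3B, gc3C, comul_one, comul_ι, map_add, map_neg, TensorProduct.map_tmul,
    TensorProduct.add_tmul, TensorProduct.comm_tmul, TensorProduct.assoc_tmul, barT_one, barT_ι,
    LinearMap.mulRight_apply, LinearMap.mulLeft_apply, one_mul, mul_one, Th,
    TensorProduct.neg_tmul]
  abel

lemma gc3_crossSlots (a b : Hsp g) :
    gc3 g (TensorAlgebra.ι ℚ a) 1 (TensorAlgebra.ι ℚ b) 1 =
      3 • Th g (TensorAlgebra.ι ℚ a) 1 (TensorAlgebra.ι ℚ b) 1
        + Th g 1 (TensorAlgebra.ι ℚ a) 1 (TensorAlgebra.ι ℚ b)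
        - Th g (TensorAlgebra.ι ℚ a) 1 1 (TensorAlgebra.ι ℚ b)
        - Th g 1 (TensorAlgebra.ι ℚ a) (TensorAlgebra.ι ℚ b) 1 := by
  simp only [gc3, gc3B, gc3C, comul_one, comul_ι, map_add, map_neg, TensorProduct.map_tmul,
    TensorProduct.add_tmul, TensorProduct.tmul_add, TensorProduct.comm_tmul,
    TensorProduct.assoc_tmul, barT_one, barT_ι,
    LinearMap.mulRight_apply, LinearMap.mulLeft_apply, one_mul, mul_one, Th,
    TensorProduct.neg_tmul, TensorProduct.tmul_neg]
  abel

variable {V : Type*} [AddCommGroup V] [Module ℚ V]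

lemma IsThetaInvariant.sideSlots_eq_of_gc3 {L : T4 g →ₗ[ℚ] V} (hL : IsThetaInvariant L)
    (hgc : ∀ t u v w, L (gc3 g t u v w) = 0) (a b : Hsp g) :
    sideSlots L a b = (2 : ℚ) • sameSlot L a b := by
  have h := hgc (TensorAlgebra.ι ℚ a) (TensorAlgebra.ι ℚ b) 1 1
  have hs : L (Th g 1 (TensorAlgebra.ι ℚ a * TensorAlgebra.ι ℚ b) 1 1) = sameSlot L b a := by
    simpa [sameSlot_apply] using hL.sides (TensorAlgebra.ι ℚ b * TensorAlgebra.ι ℚ a) 1 1 1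
  rw [gc3_sideSlots, map_sub, map_add, hs, hL.sameSlot_symm, sub_eq_zero] at h
  rw [sideSlots_apply, ← h, two_smul]
  rfl

lemma IsThetaInvariant.crossSlots_eq_of_gc3 {L : T4 g →ₗ[ℚ] V} (hL : IsThetaInvariant L)
    (hgc : ∀ t u v w, L (gc3 g t u v w) = 0) (a b : Hsp g) :
    crossSlots L a b = sameSlot L a b := by
  have h := hgc (TensorAlgebra.ι ℚ a) 1 (TensorAlgebra.ι ℚ b) 1
  have hs : L (Th g 1 (TensorAlgebra.ι ℚ a) 1 (TensorAlgebra.ι ℚ b)) = crossSlots L a b := by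
    simpa [crossSlots_apply, Th_neg₂, Th_neg₄] using
      hL.sides (TensorAlgebra.ι ℚ a) 1 (TensorAlgebra.ι ℚ b) 1
  rw [gc3_crossSlots, map_sub, map_sub, map_add, map_nsmul, hs, hL.innerSlots_eq,
    hL.outerSlots_eq, hL.outerSlots_eq, ← crossSlots_apply, hL.sideSlots_symm b a,
    hL.crossSlots_symm b a, hL.sameSlot_symm b a, hL.sideSlots_eq_of_gc3 hgc] at h
  have h' : (2 : ℚ) • (crossSlots L a b - sameSlot L a b) = 0 := by
    rw [← h]
    module
  exact sub_eq_zero.mp ((smul_eq_zero.mp h').resolve_left two_ne_zero)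

/-- The inverse of `omegaCoord` in degree two. -/
def omegaSection (g : ℕ) : SymP g 2 →ₗ[ℚ] Omega2 g :=
  polySection ((1 / 2 : ℚ) • sameSlot (Submodule.span ℚ (OmegaRel g)).mkQ) ∘ₗ Submodule.subtype _

lemma omegaSection_mem (p : SymP g 2) : omegaSection g p ∈ Omega2deg g 2 :=
  polySection_mem _ _ (fun a b => Submodule.smul_mem _ _
    (Submodule.mem_map_of_mem (sameSlot_mem_T4deg a b))) _

lemma coe_omegaFunctional_sameSlot (a b : Hsp g) :
    (omegaFunctional g (Th g (TensorAlgebra.ι ℚ a * TensorAlgebra.ι ℚ b) 1 1 1) :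
      MvPolynomial (Fin (2 * g)) ℚ) = (2 : ℚ) • (linForm g a * linForm g b) := by
  rw [coe_omegaFunctional, quadEval_sameSlot, quadEval_sameSlot]
  module

lemma omegaCoord_omegaSection (p : SymP g 2) : omegaCoord g (omegaSection g p) = p := by
  have h := map_polySection_eq_smul (p := p) (c := 1)
    (B := (1 / 2 : ℚ) • sameSlot (Submodule.span ℚ (OmegaRel g)).mkQ)
    (L := Submodule.subtype _ ∘ₗ omegaCoord g) fun a b => by
      rw [LinearMap.smul_apply, LinearMap.smul_apply, map_smul]
      change (1 / 2 : ℚ) • (omegaFunctional g (Th g _ 1 1 1) : MvPolynomial (Fin (2 * g)) ℚ) = _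
      rw [coe_omegaFunctional_sameSlot, smul_smul]
      norm_num
  rw [one_smul] at h
  exact Subtype.ext h

lemma omegaSection_omegaCoord {x : Omega2 g} (hx : x ∈ Omega2deg g 2) :
    omegaSection g (omegaCoord g x) = x := by
  set F : Omega2 g →ₗ[ℚ] Omega2 g := LinearMap.id - omegaSection g ∘ₗ omegaCoord g
  obtain ⟨x, hx, rfl⟩ := hx
  have hinv := isThetaInvariant_omegaClass.comp F
  have hgc (t u v w : TA g) :
      (F ∘ₗ (Submodule.span ℚ (OmegaRel g)).mkQ) (gc3 g t u v w) = 0 := by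
    rw [LinearMap.comp_apply, Omega_mk_eq_zero (Or.inr (Or.inr (Or.inr ⟨t, u, v, w, rfl⟩))),
      map_zero]
  have hsame (a b : Hsp g) : sameSlot (F ∘ₗ (Submodule.span ℚ (OmegaRel g)).mkQ) a b = 0 := by
    change sameSlot (Submodule.span ℚ (OmegaRel g)).mkQ a b -
      polySection ((1 / 2 : ℚ) • sameSlot (Submodule.span ℚ (OmegaRel g)).mkQ)
        (omegaFunctional g (Th g _ 1 1 1) : MvPolynomial (Fin (2 * g)) ℚ) = 0
    rw [coe_omegaFunctional_sameSlot, polySection_smul_mul fun a b => congrArg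
      ((1 / 2 : ℚ) • ·) (isThetaInvariant_omegaClass.sameSlot_symm a b)]
    simp only [LinearMap.smul_apply]
    module
  have h := hinv.eq_zero_of_mem_T4deg hsame
    (fun a b => by rw [hinv.sideSlots_eq_of_gc3 hgc, hsame, smul_zero])
    (fun a b => by rw [hinv.crossSlots_eq_of_gc3 hgc, hsame]) hx
  exact (sub_eq_zero.mp h).symm

/-- The equivalence `Ω̃₂^{(2)} ≅ Sym²H`. -/
def omegaEquiv (g : ℕ) : Omega2deg g 2 ≃ₗ[ℚ] SymP g 2 :=
  equivOfSection (Omega2deg g 2) (omegaCoord g) (omegaSection g) omegaSection_mem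
    omegaCoord_omegaSection fun _ => omegaSection_omegaCoord

end Omega

/-- The `n = 4` row of Proposition 4.1: stably, there are `GL(H)`-equivariant linear
isomorphisms `C₁₂^{(2)} ≅ (Sym²H)^{⊕3}` and `Ω̃₂^{(2)} ≅ Sym²H`
(`C_{1,2}ℋ(4) ≅ 3[2]` and `Ω̃_{2,2} ≅ [2]` as GL-representations). -/
theorem c12_and_omega2_degree4_decomposition :
    ∃ G : ℕ, 1 ≤ G ∧ ∀ g : ℕ, G ≤ g →
      (∃ e : ↥(C12deg g 2) ≃ₗ[ℚ] SymP g 2 × SymP g 2 × SymP g 2,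
        ∀ (σ : Hsp g ≃ₗ[ℚ] Hsp g) (p : P2 g)
          (hx : Submodule.Quotient.mk p ∈ C12deg g 2)
          (hy : Submodule.Quotient.mk (P2map g σ.toLinearMap p) ∈ C12deg g 2),
          (↑(e ⟨Submodule.Quotient.mk (P2map g σ.toLinearMap p), hy⟩).1 :
              MvPolynomial (Fin (2 * g)) ℚ)
            = polyAct g σ ↑(e ⟨Submodule.Quotient.mk p, hx⟩).1 ∧
          (↑(e ⟨Submodule.Quotient.mk (P2map g σ.toLinearMap p), hy⟩).2.1 :
              MvPolynomial (Fin (2 * g)) ℚ)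
            = polyAct g σ ↑(e ⟨Submodule.Quotient.mk p, hx⟩).2.1 ∧
          (↑(e ⟨Submodule.Quotient.mk (P2map g σ.toLinearMap p), hy⟩).2.2 :
              MvPolynomial (Fin (2 * g)) ℚ)
            = polyAct g σ ↑(e ⟨Submodule.Quotient.mk p, hx⟩).2.2) ∧
      (∃ e' : ↥(Omega2deg g 2) ≃ₗ[ℚ] SymP g 2,
        ∀ (σ : Hsp g ≃ₗ[ℚ] Hsp g) (x : T4 g)
          (hx : Submodule.Quotient.mk x ∈ Omega2deg g 2)
          (hy : Submodule.Quotient.mk (T4map g σ.toLinearMap x) ∈ Omega2deg g 2),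
          (↑(e' ⟨Submodule.Quotient.mk (T4map g σ.toLinearMap x), hy⟩) :
              MvPolynomial (Fin (2 * g)) ℚ)
            = polyAct g σ ↑(e' ⟨Submodule.Quotient.mk x, hx⟩)) := by
  refine ⟨1, le_rfl, fun g _ => ⟨⟨c12Equiv g, fun σ p hx hy => ?_⟩,
    ⟨omegaEquiv g, fun σ x hx hy => ?_⟩⟩⟩
  · simp only [c12Equiv, equivOfSection_apply, c12Coord_mk, P2map, thetaCoord, dumbbellCoord,
      LinearMap.prodMap_apply, LinearMap.prod_apply, Function.prod, LinearMap.add_apply,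
      LinearMap.smul_apply, Prod.mk_add_mk, Submodule.coe_add, Submodule.coe_smul, map_add,
      map_smul, coe_symQuad, quadEval_T4map, and_self]
  · simp only [omegaEquiv, equivOfSection_apply, omegaCoord_mk, coe_omegaFunctional,
      quadEval_T4map, map_sub, map_smul]
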